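/- Let g ≥ 2 and let G be the surface group with the symmetric presentation on generators c₁,…,c_{2g}. Then for every integer n ≥ 1, the conjugator length function of G satisfies n − 1 ≤ CL(2n) = CL(2n+1) ≤ n + 8g − 1. -/

import Mathlib

namespace SG

/-- A letter of the alphabet `S± = {cᵢ^{±1}}`: `(i, true)` is `c_{i+1}`,
`(i, false)` is `c_{i+1}⁻¹`. -/
abbrev Letter (g : ℕ) := Fin (2*g) × Bool

/-- A word in the alphabet `S±`. -/
abbrev Word (g : ℕ) := List (Letter g)

/-- The surface relator `c₁c₂⋯c_{2g}c₁⁻¹c₂⁻¹⋯c_{2g}⁻¹` in the free group. -/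
def relator (g : ℕ) : FreeGroup (Fin (2*g)) :=
  (List.ofFn fun i : Fin (2*g) => FreeGroup.of i).prod *
  (List.ofFn fun i : Fin (2*g) => (FreeGroup.of i)⁻¹).prod

/-- The surface group with the symmetric presentation. -/
abbrev SurfaceGroup (g : ℕ) :=
  PresentedGroup ({relator g} : Set (FreeGroup (Fin (2*g))))

/-- The generator `c_{i+1}` of the surface group. -/
def gen (g : ℕ) (i : Fin (2*g)) : SurfaceGroup g := PresentedGroup.of i

/-- The inverse of a letter. -/
def invLetter (g : ℕ) (a : Letter g) : Letter g := (a.1, !a.2)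

/-- The group element represented by a letter. -/
def evalLetter (g : ℕ) (a : Letter g) : SurfaceGroup g :=
  if a.2 then gen g a.1 else (gen g a.1)⁻¹

/-- The group element represented by a word. -/
def eval (g : ℕ) (W : Word g) : SurfaceGroup g := (W.map (evalLetter g)).prod

/-- The formal inverse `x_n⁻¹ ⋯ x₁⁻¹` of a word `x₁ ⋯ x_n`. -/
def wordInv (g : ℕ) (W : Word g) : Word g := (W.map (invLetter g)).reverse

/-- Word length of a group element: the least `n` such that the element is a
product of `n` elements of `S ∪ S⁻¹`. -/
noncomputable def len (g : ℕ) (u : SurfaceGroup g) : ℕ :=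
  sInf {n | ∃ W : Word g, W.length = n ∧ eval g W = u}

/-- `conjLen g u v` is the minimum of `|x|` over conjugators `x` with `x⁻¹ux = v`. -/
noncomputable def conjLen (g : ℕ) (u v : SurfaceGroup g) : ℕ :=
  sInf {k | ∃ x : SurfaceGroup g, x⁻¹ * u * x = v ∧ len g x = k}

/-- The conjugator length function: `CL g n` is the least `N` such that any
conjugate `u, v` with `|u| + |v| ≤ n` admit a conjugator of length `≤ N`. -/
noncomputable def CL (g : ℕ) (n : ℕ) : ℕ :=
  sInf {N | ∀ u v : SurfaceGroup g,
    (∃ x : SurfaceGroup g, x⁻¹ * u * x = v) → len g u + len g v ≤ n →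
      conjLen g u v ≤ N}

/-- Rank of a letter in the ascending order
`c_{2g} ≺ ⋯ ≺ c₂ ≺ c₁ ≺ c₁⁻¹ ≺ c₂⁻¹ ≺ ⋯ ≺ c_{2g}⁻¹`. -/
def rank (g : ℕ) (a : Letter g) : ℕ :=
  if a.2 then (2*g - 1) - (a.1 : ℕ) else 2*g + (a.1 : ℕ)

/-- The strict order `≺` on letters. -/
def letterLt (g : ℕ) (a b : Letter g) : Prop := rank g a < rank g b

/-- The length-lexicographical order `≺` on words. -/
def wordLt (g : ℕ) (X Y : Word g) : Prop :=
  X.length < Y.length ∨ (X.length = Y.length ∧ List.Lex (letterLt g) X Y)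

/-- A word is irreducible if it is the `≺`-least word representing its element. -/
def IrreducibleWord (g : ℕ) (W : Word g) : Prop :=
  ∀ W' : Word g, eval g W' = eval g W → W' = W ∨ wordLt g W W'

/-- A word is cyclically irreducible if all its cyclic permutations are irreducible. -/
def CyclicallyIrreducibleWord (g : ℕ) (W : Word g) : Prop :=
  ∀ W' : Word g, List.IsRotated W W' → IrreducibleWord g W'

/-- A word is freely reduced if no letter is followed by its inverse. -/
def FreelyReduced (g : ℕ) (W : Word g) : Prop :=
  List.Chain' (fun a c => c ≠ invLetter g a) W

/-- The normal form of a group element: the `≺`-least word representing it. -/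
noncomputable def nf (g : ℕ) (x : SurfaceGroup g) : Word g := by
  classical
  exact if h : ∃ W : Word g, eval g W = x ∧ IrreducibleWord g W then h.choose else []

/-- The word `R = c₁c₂⋯c_{2g}c₁⁻¹c₂⁻¹⋯c_{2g}⁻¹`. -/
def Rword (g : ℕ) : Word g :=
  (List.ofFn fun i : Fin (2*g) => ((i, true) : Letter g)) ++
  (List.ofFn fun i : Fin (2*g) => ((i, false) : Letter g))

/-- `𝓡`: all cyclic permutations of `R` and of `R⁻¹`. -/
def RSet (g : ℕ) : Set (Word g) :=
  {W | List.IsRotated (Rword g) W ∨ List.IsRotated (wordInv g (Rword g)) W}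

/-- `seg g b i k` is the word `b_i b_{i+1} ⋯ b_{i+k-1}`. -/
def seg (g : ℕ) (b : ℕ → Letter g) (i k : ℕ) : Word g :=
  (List.range k).map fun j => b (i + j)

/-- `dseg g b i k` is the descending word `b_i b_{i-1} ⋯ b_{i-k+1}`
(indices taken modulo `4g`, using periodicity of `b`). -/
def dseg (g : ℕ) (b : ℕ → Letter g) (i k : ℕ) : Word g :=
  (List.range k).map fun j => b (i + 4*g - j)

/-- `b : ℕ → Letter g` is a `4g`-periodic (1-based) enumeration of the letters
`b₁, …, b_{4g}` of some word `b₁⋯b_{4g} ∈ 𝓡`. -/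
def RelSeq (g : ℕ) (b : ℕ → Letter g) : Prop :=
  (∀ i, b (i + 4*g) = b i) ∧ seg g b 1 (4*g) ∈ RSet g

/-- The `t`-th power `W^t` of a word. -/
def wpow (g : ℕ) (W : Word g) (t : ℕ) : Word g := (List.replicate t W).flatten

/-- A `k`-fractional relator: an initial segment of length `k` (with `2 ≤ k ≤ 4g`)
of some word in `𝓡`. -/
def IsFR (g : ℕ) (k : ℕ) (W : Word g) : Prop :=
  2 ≤ k ∧ k ≤ 4*g ∧ ∃ B ∈ RSet g, W = B.take k

/-- `IsLLFROcc g k W P F Q` : the factorization `W = P ++ F ++ Q` exhibits `F`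
as a `k`-locally longest fractional relator of `W`. -/
def IsLLFROcc (g : ℕ) (k : ℕ) (W P F Q : Word g) : Prop :=
  W = P ++ F ++ Q ∧ IsFR g k F ∧
  (∀ a, P.getLast? = some a → ¬ IsFR g (k+1) (a :: F)) ∧
  (∀ a, Q.head? = some a → ¬ IsFR g (k+1) (F ++ [a]))

/-- `W` contains a `k`-LLFR. -/
def HasLLFR (g : ℕ) (k : ℕ) (W : Word g) : Prop :=
  ∃ P F Q, IsLLFROcc g k W P F Q

/-- Length-lexicographical order on pairs of words. -/
def pairLt (g : ℕ) (p q : Word g × Word g) : Prop :=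
  wordLt g p.1 q.1 ∨ (p.1 = q.1 ∧ wordLt g p.2 q.2)

/-- A candidate for the reducing-subword pair of `(W₁, W₂)`. -/
def IsRSCand (g : ℕ) (W₁ W₂ C₁ C₂ : Word g) : Prop :=
  ∃ A B C' : Word g, W₁ = A ++ C₁ ∧ W₂ = C₂ ++ B ∧
    nf g (eval g (W₁ ++ W₂)) = A ++ C' ++ B

/-- `(C₁, C₂)` is the reducing-subword pair `rs(W₁, W₂)`: the `≺`-least candidate. -/
def IsRS (g : ℕ) (W₁ W₂ C₁ C₂ : Word g) : Prop :=
  IsRSCand g W₁ W₂ C₁ C₂ ∧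
  ∀ D₁ D₂ : Word g, IsRSCand g W₁ W₂ D₁ D₂ →
    (C₁ = D₁ ∧ C₂ = D₂) ∨ pairLt g (C₁, C₂) (D₁, D₂)

end SG

namespace SGP
open SG

section generic
variable {K : Type*} [Group K]

/-- cyclic word letters -/
def cw (g : ℕ) (f : ℕ → K) (k : ℕ) : K :=
  if (k / (2*g)) % 2 = 0 then f (k % (2*g)) else (f (k % (2*g)))⁻¹

/-- prefix products -/
def Z (g : ℕ) (f : ℕ → K) : ℕ → K
  | 0 => 1
  | k+1 => Z g f k * cw g f k

lemma Z_zero (g : ℕ) (f : ℕ → K) : Z g f 0 = 1 := rfl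
lemma Z_succ (g : ℕ) (f : ℕ → K) (k : ℕ) : Z g f (k+1) = Z g f k * cw g f k := rfl

lemma ofFn_range {α : Type*} (f : ℕ → α) (n : ℕ) :
    List.ofFn (fun i : Fin n => f i) = (List.range n).map f := by
  apply List.ext_getElem <;> simp

lemma cw_lt (g : ℕ) (f : ℕ → K) (k : ℕ) (h : k < 2*g) : cw g f k = f k := by
  unfold cw; rw [Nat.div_eq_of_lt h, Nat.mod_eq_of_lt h]; simp

lemma cw_add (g : ℕ) (hg : 0 < g) (f : ℕ → K) (k : ℕ) : cw g f (k + 2*g) = (cw g f k)⁻¹ := by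
  unfold cw
  rw [Nat.add_div_right _ (by omega), Nat.add_mod_right]
  rcases Nat.mod_two_eq_zero_or_one (k/(2*g)) with h | h
  · rw [if_neg (by omega), if_pos h]
  · rw [if_pos (by omega), if_neg (by omega), inv_inv]

lemma Z_range (g : ℕ) (f : ℕ → K) (n : ℕ) (h : n ≤ 2*g) :
    ((List.range n).map f).prod = Z g f n := by
  induction n with
  | zero => simp [Z]
  | succ n ih =>
    rw [List.range_succ, List.map_append, List.prod_append, ih (by omega), Z_succ, cw_lt _ _ _ (by omega)]
    simp

lemma Z_range2 (g : ℕ) (hg : 0 < g) (f : ℕ → K) (n : ℕ) (h : n ≤ 2*g) :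
    Z g f (2*g) * ((List.range n).map (fun i => (f i)⁻¹)).prod = Z g f (2*g + n) := by
  induction n with
  | zero => simp
  | succ n ih =>
    rw [List.range_succ, List.map_append, List.prod_append, ← mul_assoc, ih (by omega),
      ← Nat.add_assoc, Z_succ, add_comm (2*g) n, cw_add _ hg, cw_lt _ _ _ (by omega)]
    simp

lemma lift_relator (g : ℕ) (hg : 0 < g) (f : ℕ → K) :
    FreeGroup.lift (fun i : Fin (2*g) => f i) (relator g) = Z g f (4*g) := by
  unfold relator
  rw [map_mul, map_list_prod, map_list_prod, List.map_ofFn, List.map_ofFn]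
  have h1 : (⇑(FreeGroup.lift (fun i : Fin (2*g) => f i)) ∘ fun i => FreeGroup.of i) =
    fun i : Fin (2*g) => f i := by ext; simp
  have h2 : (⇑(FreeGroup.lift (fun i : Fin (2*g) => f i)) ∘ fun i => (FreeGroup.of i)⁻¹) =
    fun i : Fin (2*g) => (fun k => (f k)⁻¹) i := by ext; simp
  rw [h1, h2, ofFn_range, ofFn_range (fun k => (f k)⁻¹), Z_range _ _ _ le_rfl, Z_range2 _ hg _ _ le_rfl]
  congr 1; omega

lemma Z_half (g : ℕ) (hg : 0 < g) (f : ℕ → K) (n : ℕ) :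
    Z g f (n + 4*g) = Z g f (4*g) * Z g f n := by
  induction n with
  | zero => simp [Z]
  | succ n ih =>
    rw [show n+1+4*g = (n + 4*g)+1 by omega, Z_succ, ih, Z_succ, show n+4*g = n+2*g+2*g by omega,
      cw_add _ hg, cw_add _ hg, inv_inv, mul_assoc]

lemma map_Z {K' : Type*} [Group K'] (φ : K →* K') (g : ℕ) (f : ℕ → K) (f' : ℕ → K')
    (hg : 0 < g) (h : ∀ i < 2*g, φ (f i) = f' i) (m : ℕ) : φ (Z g f m) = Z g f' m := by
  induction m with
  | zero => simp [Z]
  | succ m ih =>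
    rw [Z_succ, Z_succ, map_mul, ih]
    congr 1
    unfold cw
    split_ifs
    · exact h _ (Nat.mod_lt _ (by omega))
    · rw [map_inv, h _ (Nat.mod_lt _ (by omega))]

end generic

/-- generators, nat indexed -/
def gn (g : ℕ) (k : ℕ) : SurfaceGroup g := if h : k < 2*g then gen g ⟨k, h⟩ else 1

lemma gn_fin (g : ℕ) (i : Fin (2*g)) : gn g i = gen g i := by
  unfold gn; simp

/-- polygon vertices -/
def Y (g : ℕ) (m : ℕ) : SurfaceGroup g := Z g (gn g) m

theorem exists_hom {K : Type*} [Group K] (g : ℕ) (hg : 0 < g) (f : ℕ → K) (h : Z g f (4*g) = 1) :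
    ∃ φ : SurfaceGroup g →* K, (∀ i : Fin (2*g), φ (gen g i) = f i) ∧ ∀ m, φ (Y g m) = Z g f m := by
  have hr : ∀ r ∈ ({relator g} : Set (FreeGroup (Fin (2*g)))),
      FreeGroup.lift (fun i : Fin (2*g) => f i) r = 1 := by
    intro r hr
    rw [Set.mem_singleton_iff] at hr
    rw [hr, lift_relator g hg, h]
  refine ⟨PresentedGroup.toGroup hr, fun i => ?_, fun m => ?_⟩
  · exact PresentedGroup.toGroup.of hr
  · refine map_Z _ g _ _ hg ?_ m
    intro i hi
    unfold gn; rw [dif_pos hi]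
    exact PresentedGroup.toGroup.of hr

lemma Y_zero (g : ℕ) : Y g 0 = 1 := rfl

lemma Y_4g (g : ℕ) (hg : 0 < g) : Y g (4*g) = 1 := by
  unfold Y
  rw [← lift_relator g hg]
  have h : FreeGroup.lift (fun i : Fin (2*g) => gn g i) =
      PresentedGroup.mk ({relator g} : Set (FreeGroup (Fin (2*g)))) := by
    ext i
    rw [FreeGroup.lift_apply_of, gn_fin]; rfl
  rw [h]
  exact PresentedGroup.one_of_mem rfl

lemma Y_add (g : ℕ) (hg : 0 < g) (m : ℕ) : Y g (m + 4*g) = Y g m := by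
  unfold Y; rw [Z_half _ hg]
  have := Y_4g g hg
  unfold Y at this
  rw [this, one_mul]

/-- letters around the polygon -/
def L (g : ℕ) (hg : 0 < g) (k : ℕ) : Letter g :=
  (⟨k % (2*g), Nat.mod_lt _ (by omega)⟩, decide ((k/(2*g)) % 2 = 0))

lemma evalLetter_true (g : ℕ) (i : Fin (2*g)) : evalLetter g (i, true) = gen g i := rfl
lemma evalLetter_false (g : ℕ) (i : Fin (2*g)) : evalLetter g (i, false) = (gen g i)⁻¹ := rfl
lemma evalLetter_inv (g : ℕ) (a : Letter g) : evalLetter g (invLetter g a) = (evalLetter g a)⁻¹ := by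
  rcases a with ⟨i, _ | _⟩ <;> simp [invLetter, evalLetter]
lemma invLetter_inv (g : ℕ) (a : Letter g) : invLetter g (invLetter g a) = a := by
  simp [invLetter]

lemma Y_succ (g : ℕ) (hg : 0 < g) (m : ℕ) : Y g (m+1) = Y g m * evalLetter g (L g hg m) := by
  unfold Y; rw [Z_succ]; congr 1
  unfold cw L
  split_ifs with h
  · simp only [h, evalLetter]; simp; unfold gn; rw [dif_pos]
  · simp only [h, evalLetter]; simp; unfold gn; rw [dif_pos]

lemma eval_nil (g : ℕ) : eval g [] = 1 := rfl
lemma eval_cons (g : ℕ) (a : Letter g) (w : Word g) : eval g (a :: w) = evalLetter g a * eval g w := by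
  simp [eval]
lemma eval_append (g : ℕ) (v w : Word g) : eval g (v ++ w) = eval g v * eval g w := by
  simp [eval]
lemma eval_wordInv (g : ℕ) (w : Word g) : eval g (wordInv g w) = (eval g w)⁻¹ := by
  induction w with
  | nil => simp [wordInv, eval]
  | cons a w ih =>
    have : wordInv g (a :: w) = wordInv g w ++ [invLetter g a] := by simp [wordInv]
    rw [this, eval_append, ih, eval_cons, eval_cons, eval_nil, evalLetter_inv]; simp

lemma eval_surj (g : ℕ) (x : SurfaceGroup g) : ∃ w, eval g w = x := by
  obtain ⟨y, rfl⟩ := PresentedGroup.mk_surjective _ x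
  induction y using FreeGroup.induction_on with
  | C1 => exact ⟨[], by simp [eval]⟩
  | of i => exact ⟨[(i, true)], by simp [eval, evalLetter]; rfl⟩
  | inv_of i _ => exact ⟨[(i, false)], by simp [eval, evalLetter]; rfl⟩
  | mul a b ha hb =>
    obtain ⟨v, hv⟩ := ha
    obtain ⟨w, hw⟩ := hb
    exact ⟨v ++ w, by rw [eval_append, hv, hw, map_mul]⟩

/-- right induction -/
lemma G_induction (g : ℕ) {P : SurfaceGroup g → Prop} (y : SurfaceGroup g) (h1 : P y)
    (h : ∀ x i, P (x * gen g i) ↔ P x) (x : SurfaceGroup g) : P x := by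
  have key : ∀ (w : Word g) (x : SurfaceGroup g), P x → P (x * eval g w) := by
    intro w
    induction w with
    | nil => intro x hx; simpa [eval] using hx
    | cons a w ih =>
      intro x hx
      rw [eval_cons, ← mul_assoc]
      apply ih
      rcases a with ⟨i, _ | _⟩
      · rw [evalLetter_false, ← h _ i]; simpa using hx
      · rw [evalLetter_true, h]; exact hx
  obtain ⟨w, hw⟩ := eval_surj g (y⁻¹ * x)
  have := key w y h1
  rw [hw] at this; simpa using this

lemma len_le (g : ℕ) (w : Word g) : len g (eval g w) ≤ w.length := Nat.sInf_le ⟨w, rfl, rfl⟩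

lemma exists_len (g : ℕ) (x : SurfaceGroup g) : ∃ w : Word g, w.length = len g x ∧ eval g w = x := by
  obtain ⟨w, hw⟩ := eval_surj g x
  exact Nat.sInf_mem (s := {n | ∃ W : Word g, W.length = n ∧ eval g W = x}) ⟨w.length, w, rfl, hw⟩

end SGP

namespace SGP
open SG

/-- wall stabilizer generator -/
def tt (g : ℕ) (i : Fin (2*g)) : SurfaceGroup g := Y g i * (Y g (i + 2*g + 1))⁻¹

/-- wall stabilizer -/
def T (g : ℕ) (i : Fin (2*g)) : Subgroup (SurfaceGroup g) := Subgroup.zpowers (tt g i)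

lemma tt_mem (g : ℕ) (i : Fin (2*g)) : tt g i ∈ T g i := Subgroup.mem_zpowers _

open Classical in
/-- crossing indicator -/
noncomputable def chi (g : ℕ) (i : Fin (2*g)) (x : SurfaceGroup g) (j : ℕ) : ZMod 2 :=
  if j = i ∧ x * (Y g i)⁻¹ ∈ T g i then 1 else 0

lemma z2 (a : ZMod 2) : a + a = 0 := by revert a; decide

/-- the permutations -/
noncomputable def rr (g : ℕ) (i : Fin (2*g)) (j : ℕ) : Equiv.Perm (SurfaceGroup g × ZMod 2) where
  toFun p := (p.1 * (gn g j)⁻¹, p.2 + chi g i (p.1 * (gn g j)⁻¹) j)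
  invFun p := (p.1 * gn g j, p.2 + chi g i p.1 j)
  left_inv p := by ext <;> simp [add_assoc, z2]
  right_inv p := by ext <;> simp [add_assoc, z2]

lemma rr_apply (g : ℕ) (i : Fin (2*g)) (j : ℕ) (x : SurfaceGroup g) (s : ZMod 2) :
   rr g i j (x * gn g j, s) = (x, s + chi g i x j) := by
  simp [rr]
lemma rr_inv_apply (g : ℕ) (i : Fin (2*g)) (j : ℕ) (x : SurfaceGroup g) (s : ZMod 2) :
   (rr g i j)⁻¹ (x, s) = (x * gn g j, s + chi g i x j) := by
  rfl

open Classical in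
lemma rr_Z (g : ℕ) (hg : 0 < g) (i : Fin (2*g)) (m : ℕ) (hm : m ≤ 4*g) (x : SurfaceGroup g) (s : ZMod 2) :
    Z g (rr g i) m (x * Y g m, s) = (x, s + if (i:ℕ) < m ∧ m ≤ i + 2*g ∧ x ∈ T g i then 1 else 0) := by
  have hi := i.2
  induction m generalizing s with
  | zero => simp [Z, Y]
  | succ m ih =>
    rw [Z_succ, Equiv.Perm.mul_apply]
    have hY : Y g (m+1) = Y g m * cw g (gn g) m := rfl
    by_cases h : m < 2*g
    · rw [cw_lt _ _ _ h, hY, cw_lt _ _ _ h, ← mul_assoc, rr_apply, ih (by omega)]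
      congr 1
      rw [add_assoc]; congr 1
      unfold chi
      by_cases hmi : m = i
      · subst hmi
        by_cases hx : x ∈ T g i
        · simp [hx]; intro; omega
        · simp [hx]
      · simp only [hmi, false_and, if_false, zero_add]
        congr 1
        have : (i:ℕ) < m ↔ (i:ℕ) < m+1 := by omega
        rw [this]
        have : m ≤ i+2*g ↔ m+1 ≤ i+2*g := by omega
        rw [this]
    · obtain ⟨k, rfl⟩ : ∃ k, m = k + 2*g := ⟨m-2*g, by omega⟩
      rw [cw_add _ hg, cw_lt _ _ _ (by omega), rr_inv_apply]
      have : x * Y g (k + 2*g + 1) * gn g k = x * Y g (k+2*g) := by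
        rw [hY, cw_add _ hg, cw_lt _ _ _ (by omega)]; simp [mul_assoc]
      rw [this, ih (by omega)]
      congr 1
      rw [add_assoc]; congr 1
      unfold chi
      by_cases hmi : k = i
      · subst hmi
        have : x * Y g (i + 2*g + 1) * (Y g i)⁻¹ = x * (tt g i)⁻¹ := by
          unfold tt; simp [mul_assoc]
        rw [this, Subgroup.mul_mem_cancel_right _ (inv_mem (tt_mem g i))]
        by_cases hx : x ∈ T g i
        · simp [hx]
          rw [if_pos (by omega)]; decide
        · simp [hx]
      · simp only [hmi, false_and, if_false, zero_add]
        congr 1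
        have : (i:ℕ) < k + 2*g ↔ (i:ℕ) < k + 2*g+1 := by omega
        rw [this]
        have : k+2*g ≤ i+2*g ↔ k+2*g+1 ≤ i+2*g := by omega
        rw [this]

theorem exists_sigma (g : ℕ) (hg : 0 < g) (i : Fin (2*g)) :
    ∃ σ : SurfaceGroup g → ZMod 2, ∀ x (j : Fin (2*g)), σ (x * gen g j) = σ x + chi g i x j := by
  have h1 : Z g (rr g i) (4*g) = 1 := by
    ext1 ⟨x, s⟩
    have := rr_Z g hg i (4*g) le_rfl (x * (Y g (4*g))⁻¹) s
    rw [inv_mul_cancel_right] at this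
    rw [this, Y_4g g hg]
    have hi := i.2
    rw [if_neg (by omega)]
    simp
  obtain ⟨ρ, hρ, -⟩ := exists_hom g hg (rr g i) h1
  have hr : ∀ x j y s, ρ (x * gen g j) (y * gen g j, s) = ρ x (y, s + chi g i y j) := by
    intro x j y s
    rw [map_mul, hρ, Equiv.Perm.mul_apply, ← gn_fin, rr_apply]
  have hadd : ∀ x y s, (ρ x (y, s)).2 = s + (ρ x (y, 0)).2 := by
    intro x
    refine G_induction g (P := fun x => ∀ y s, (ρ x (y, s)).2 = s + (ρ x (y, 0)).2) 1 ?_ ?_ x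
    · intro y s; simp
    · intro x j
      constructor
      · intro h y s
        have h1 := h (y * gen g j) (s + chi g i y j)
        have h2 := h (y * gen g j) (chi g i y j)
        rw [hr, hr] at h1
        rw [hr, hr, z2] at h2
        rw [zero_add] at h1 h2
        rw [add_assoc, z2, add_zero] at h1
        rw [h1, h2, add_assoc]
      · intro h y s
        obtain ⟨z, rfl⟩ : ∃ z, y = z * gen g j := ⟨y * (gen g j)⁻¹, by simp⟩
        rw [hr, hr, h, h z (0 + _)]
        ring
  refine ⟨fun x => (ρ x (x, 0)).2, fun x j => ?_⟩
  simp only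
  rw [hr, hadd]; ring

noncomputable def sig (g : ℕ) (i : Fin (2*g)) : SurfaceGroup g → ZMod 2 :=
  open Classical in if h : 0 < g then (exists_sigma g h i).choose else 0

lemma sig_step (g : ℕ) (hg : 0 < g) (i : Fin (2*g)) (x) (j : Fin (2*g)) :
    sig g i (x * gen g j) = sig g i x + chi g i x j := by
  unfold sig; rw [dif_pos hg]; exact (exists_sigma g hg i).choose_spec x j

lemma sig_letter (g : ℕ) (hg : 0 < g) (i : Fin (2*g)) (x) (a : Letter g) (h : a.1 ≠ i) :
    sig g i (x * evalLetter g a) = sig g i x := by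
  have hc : ∀ y, chi g i y a.1 = 0 := by
    intro y; unfold chi; rw [if_neg]; rintro ⟨h1, -⟩; exact h (Fin.ext h1)
  rcases a with ⟨j, _ | _⟩
  · rw [evalLetter_false]
    have := sig_step g hg i (x * (gen g j)⁻¹) j
    rw [hc] at this
    simpa using this.symm
  · rw [evalLetter_true, sig_step g hg, hc, add_zero]

lemma sig_T (g : ℕ) (hg : 0 < g) (i : Fin (2*g)) (t) (ht : t ∈ T g i) (x) :
    sig g i (t * x) = sig g i x := by
  have hi := i.2
  have hchi : ∀ t ∈ T g i, ∀ x j, chi g i (t*x) j = chi g i x j := by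
    intro t ht x j
    unfold chi
    rw [mul_assoc, Subgroup.mul_mem_cancel_left _ ht]
  have hbase : sig g i ((tt g i)⁻¹ * Y g i) = sig g i (Y g i) := by
    have h1 : (tt g i)⁻¹ * Y g i = Y g (i + 2*g + 1) := by unfold tt; simp
    rw [h1]
    have h2 : ∀ k, k + 1 ≤ 2*g → sig g i (Y g (i+2*g+1+k)) = sig g i (Y g (i+2*g+1)) := by
      intro k hk
      induction k with
      | zero => rfl
      | succ k ih =>
        rw [← Nat.add_assoc, Y_succ g hg, sig_letter g hg, ih (by omega)]
        unfold L
        intro h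
        have := congrArg Fin.val h
        simp only at this
        by_cases h3 : (i:ℕ) + 1 + k < 2*g
        · rw [show (i:ℕ)+2*g+1+k = (i+1+k)+2*g by ring, Nat.add_mod_right, Nat.mod_eq_of_lt h3] at this
          omega
        · obtain ⟨l, hl⟩ : ∃ l, (i:ℕ)+1+k = l + 2*g := ⟨i+1+k-2*g, by omega⟩
          rw [show (i:ℕ)+2*g+1+k = (i+1+k)+2*g by ring, Nat.add_mod_right, hl, Nat.add_mod_right,
             Nat.mod_eq_of_lt (by omega)] at this
          omega
    rw [← h2 (2*g-1) (by omega), show (i:ℕ)+2*g+1+(2*g-1) = i + 4*g by omega, Y_add g hg]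
  have hall : ∀ x, sig g i ((tt g i)⁻¹ * x) = sig g i x := by
    intro x
    refine G_induction g (P := fun x => sig g i ((tt g i)⁻¹ * x) = sig g i x) (Y g i) hbase ?_ x
    intro x j
    rw [← mul_assoc, sig_step g hg, sig_step g hg, hchi _ (inv_mem (tt_mem g i))]
    exact add_left_inj _
  obtain ⟨n, rfl⟩ := Subgroup.mem_zpowers_iff.1 ht
  have : ∀ n : ℤ, ∀ x, sig g i ((tt g i)^n * x) = sig g i x := by
    intro n
    induction n using Int.induction_on with
    | zero => simp
    | succ n ih =>
      intro x
      rw [zpow_add_one, mul_assoc, ih, ← hall (tt g i * x)]; simp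
    | pred n ih =>
      intro x
      rw [zpow_sub_one, mul_assoc, ih, hall]
  exact this n x

/-- the basic half-space of type `i` -/
def B (g : ℕ) (i : Fin (2*g)) : Set (SurfaceGroup g) := {x | sig g i x ≠ sig g i (Y g i)}

lemma B_step (g : ℕ) (hg : 0 < g) (i : Fin (2*g)) (x) (j : Fin (2*g)) :
    (x * gen g j ∈ B g i ↔ x ∈ B g i) ↔ ¬ (j = i ∧ x * (Y g i)⁻¹ ∈ T g i) := by
  unfold B
  simp only [Set.mem_ofPred_eq]
  rw [sig_step g hg]
  unfold chi
  rw [← Fin.val_inj]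
  by_cases h : (j:ℕ) = i ∧ x * (Y g i)⁻¹ ∈ T g i
  · rw [if_pos h]
    simp only [h, not_true_eq_false, and_self, iff_false]
    generalize sig g i x = a
    generalize sig g i _ = b
    revert a b; decide
  · rw [if_neg h]; simp [h]

lemma B_T (g : ℕ) (hg : 0 < g) (i : Fin (2*g)) (t) (ht : t ∈ T g i) (x) :
    t * x ∈ B g i ↔ x ∈ B g i := by
  unfold B
  simp only [Set.mem_ofPred_eq]
  rw [sig_T g hg i t ht]

lemma B_not (g : ℕ) (hg : 0 < g) (i : Fin (2*g)) (x) (h : x * (Y g i)⁻¹ ∈ T g i) : x ∉ B g i := by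
  have := B_T g hg i _ h (Y g i)
  rw [inv_mul_cancel_right] at this
  rw [this]
  simp [B]

lemma B_in (g : ℕ) (hg : 0 < g) (i : Fin (2*g)) (x) (h : x * (Y g i)⁻¹ ∈ T g i) :
    x * gen g i ∈ B g i := by
  have h1 := (B_step g hg i x i).not_left.2 ⟨rfl, h⟩
  have h2 := B_not g hg i x h
  tauto

/-- crossing from outside to inside -/
lemma B_enter (g : ℕ) (hg : 0 < g) (i : Fin (2*g)) (x) (a : Letter g) (h1 : x ∉ B g i)
    (h2 : x * evalLetter g a ∈ B g i) : a = (i, true) ∧ x * (Y g i)⁻¹ ∈ T g i := by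
  rcases a with ⟨j, _ | _⟩
  · rw [evalLetter_false] at h2
    have h3 := B_step g hg i (x * (gen g j)⁻¹) j
    rw [inv_mul_cancel_right] at h3
    have h4 : j = i ∧ x * (gen g j)⁻¹ * (Y g i)⁻¹ ∈ T g i := by tauto
    exact absurd h2 (B_not g hg i _ h4.2)
  · rw [evalLetter_true] at h2
    have h3 := B_step g hg i x j
    have h4 : j = i ∧ x * (Y g i)⁻¹ ∈ T g i := by tauto
    exact ⟨by rw [h4.1], h4.2⟩

lemma B_exit (g : ℕ) (hg : 0 < g) (i : Fin (2*g)) (x) (a : Letter g) (h1 : x ∈ B g i)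
    (h2 : x * evalLetter g a ∉ B g i) : a = (i, false) ∧ x * (gen g i)⁻¹ * (Y g i)⁻¹ ∈ T g i := by
  have := B_enter g hg i (x * evalLetter g a) (invLetter g a) h2 (by rw [evalLetter_inv]; simpa using h1)
  have ha : a = (i, false) := by
    rw [← invLetter_inv g a, this.1]; rfl
  subst ha
  exact ⟨rfl, this.2⟩

end SGP

namespace SGP
open SG
open scoped Pointwise

lemma mem_tr {G : Type*} [Group G] (u x : G) (S : Set G) : x ∈ u • S ↔ u⁻¹ * x ∈ S := by
  rw [Set.mem_smul_set_iff_inv_smul_mem, smul_eq_mul]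

/-- The half-space entered when going from `x` along the letter `a`. -/
def E (g : ℕ) (x : SurfaceGroup g) (a : Letter g) : Set (SurfaceGroup g) :=
  if a.2 then (x * (Y g a.1)⁻¹) • B g a.1 else ((x * (gen g a.1)⁻¹ * (Y g a.1)⁻¹) • B g a.1)ᶜ

/-- Half-spaces of type `i`. -/
def HS (g : ℕ) (i : Fin (2*g)) (S : Set (SurfaceGroup g)) : Prop := ∃ x a, a.1 = i ∧ S = E g x a
/-- Half-spaces. -/
def H (g : ℕ) (S : Set (SurfaceGroup g)) : Prop := ∃ x a, S = E g x a

/-- rail element -/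
def A (g : ℕ) (a : Letter g) : SurfaceGroup g :=
  if a.2 then (Y g a.1)⁻¹ * tt g a.1 * Y g a.1
  else (gen g a.1)⁻¹ * ((Y g a.1)⁻¹ * tt g a.1 * Y g a.1) * gen g a.1

lemma mem_E_true (g : ℕ) (x y : SurfaceGroup g) (i) : y ∈ E g x (i, true) ↔ Y g i * x⁻¹ * y ∈ B g i := by
  simp [E, mem_tr]
lemma mem_E_false (g : ℕ) (x y : SurfaceGroup g) (i) :
    y ∈ E g x (i, false) ↔ Y g i * gen g i * x⁻¹ * y ∉ B g i := by
  simp [E, mem_tr, mul_assoc]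

lemma smul_E (g : ℕ) (u x : SurfaceGroup g) (a) : u • E g x a = E g (u * x) a := by
  ext y
  rcases a with ⟨i, _ | _⟩ <;> rw [mem_tr] <;> simp [mem_E_true, mem_E_false, mul_assoc]

lemma E_compl (g : ℕ) (x : SurfaceGroup g) (a) : (E g x a)ᶜ = E g (x * evalLetter g a) (invLetter g a) := by
  ext y
  rcases a with ⟨i, _ | _⟩ <;> rw [Set.mem_compl_iff] <;>
   simp [mem_E_true, mem_E_false, invLetter, evalLetter, mul_assoc]

section

lemma notMem_E {g : ℕ} (hg : 0 < g) (x : SurfaceGroup g) (a) : x ∉ E g x a := by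
  rcases a with ⟨i, _ | _⟩
  · rw [mem_E_false, not_not]
    simpa using B_in g hg i (Y g i) (by simp)
  · rw [mem_E_true]
    simpa using B_not g hg i (Y g i) (by simp)

lemma mem_E {g : ℕ} (hg : 0 < g) (x : SurfaceGroup g) (a) : x * evalLetter g a ∈ E g x a := by
  have := notMem_E hg (x * evalLetter g a) (invLetter g a)
  rwa [← E_compl, Set.mem_compl_iff, not_not] at this

lemma E_eq_of {g : ℕ} (hg : 0 < g) (x y : SurfaceGroup g) (a) (h : x⁻¹ * y ∈ Subgroup.zpowers (A g a)) :
    E g x a = E g y a := by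
  obtain ⟨k, hk⟩ := Subgroup.mem_zpowers_iff.1 h
  obtain rfl : y = x * A g a ^ k := by rw [hk]; simp
  ext z
  have ht : tt g a.1 ^ k ∈ T g a.1 := Subgroup.zpow_mem _ (tt_mem g _) k
  have hc : ∀ p t : SurfaceGroup g, (p⁻¹ * t * p)^k = p⁻¹ * t^k * p := by
    intro p t
    have := conj_zpow (i := k) (a := p⁻¹) (b := t)
    rwa [inv_inv] at this
  rcases a with ⟨i, _ | _⟩
  · rw [mem_E_false, mem_E_false, ← B_T g hg i _ ht (Y g i * gen g i * (x * A g (i, false) ^ k)⁻¹ * z)]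
    have : A g (i, false) ^ k = (Y g i * gen g i)⁻¹ * tt g i ^ k * (Y g i * gen g i) := by
      rw [← hc]; simp [A, mul_assoc]
    rw [this]
    simp [mul_assoc]
  · rw [mem_E_true, mem_E_true, ← B_T g hg i _ ht (Y g i * (x * A g (i, true) ^ k)⁻¹ * z)]
    have : A g (i, true) ^ k = (Y g i)⁻¹ * tt g i ^ k * (Y g i) := by
      rw [← hc]; simp [A]
    rw [this]
    simp [mul_assoc]

lemma E_enter' {g : ℕ} (hg : 0 < g) (x y : SurfaceGroup g) (a b) (h1 : x ∉ E g y b) (h2 : x * evalLetter g a ∈ E g y b) :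
    a = b ∧ y⁻¹ * x ∈ Subgroup.zpowers (A g b) := by
  have hc : ∀ (k : ℤ) (p t : SurfaceGroup g), (p⁻¹ * t * p)^k = p⁻¹ * t^k * p := by
    intro k p t
    have := conj_zpow (i := k) (a := p⁻¹) (b := t)
    rwa [inv_inv] at this
  rcases b with ⟨i, _ | _⟩
  · rw [mem_E_false, not_not] at h1
    rw [mem_E_false, ← mul_assoc] at h2
    obtain ⟨h3, h4⟩ := B_exit g hg i _ _ h1 h2
    refine ⟨h3, ?_⟩
    obtain ⟨k, hk⟩ := Subgroup.mem_zpowers_iff.1 h4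
    refine Subgroup.mem_zpowers_iff.2 ⟨k, ?_⟩
    have : A g (i, false) ^ k = (Y g i * gen g i)⁻¹ * tt g i ^ k * (Y g i * gen g i) := by
      rw [← hc]; simp [A, mul_assoc]
    rw [this, hk]
    simp [mul_assoc]
  · rw [mem_E_true] at h1
    rw [mem_E_true, ← mul_assoc] at h2
    obtain ⟨h3, h4⟩ := B_enter g hg i _ _ h1 h2
    refine ⟨h3, ?_⟩
    obtain ⟨k, hk⟩ := Subgroup.mem_zpowers_iff.1 h4
    refine Subgroup.mem_zpowers_iff.2 ⟨k, ?_⟩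
    have : A g (i, true) ^ k = (Y g i)⁻¹ * tt g i ^ k * (Y g i) := by
      rw [← hc]; simp [A, mul_assoc]
    rw [this, hk]
    simp [mul_assoc]

lemma E_eq {g : ℕ} (hg : 0 < g) (x y : SurfaceGroup g) (a b) (h : E g x a = E g y b) :
    a = b ∧ x⁻¹ * y ∈ Subgroup.zpowers (A g a) := by
  have := E_enter' hg y x b a (by rw [h]; exact notMem_E hg y b) (by rw [h]; exact mem_E hg y b)
  exact ⟨this.1.symm, this.2⟩

lemma H_enter {g : ℕ} (hg : 0 < g) {S : Set (SurfaceGroup g)} (hS : H g S) (x a) (h1 : x ∉ S) (h2 : x * evalLetter g a ∈ S) :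
    S = E g x a := by
  obtain ⟨y, b, rfl⟩ := hS
  obtain ⟨rfl, h⟩ := E_enter' hg x y a b h1 h2
  exact E_eq_of hg _ _ _ h

lemma H_E {g : ℕ} (x a) : H g (E g x a) := ⟨x, a, rfl⟩
lemma H_compl {g : ℕ} {S : Set (SurfaceGroup g)} (hS : H g S) : H g Sᶜ := by
  obtain ⟨y, b, rfl⟩ := hS
  rw [E_compl]; exact H_E _ _
lemma H_smul {g : ℕ} {S : Set (SurfaceGroup g)} (hS : H g S) (u : SurfaceGroup g) : H g (u • S) := by
  obtain ⟨y, b, rfl⟩ := hS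
  rw [smul_E]; exact H_E _ _

lemma H_exit {g : ℕ} (hg : 0 < g) {S : Set (SurfaceGroup g)} (hS : H g S) (x a) (h1 : x ∈ S) (h2 : x * evalLetter g a ∉ S) :
    Sᶜ = E g x a := H_enter hg (H_compl hS) x a (by simpa using h1) h2

lemma inv_ne {g : ℕ} (a : Letter g) : invLetter g a ≠ a := by
  intro h
  have := congrArg Prod.snd h
  simp [invLetter] at this

lemma no_inversion {g : ℕ} (hg : 0 < g) {S : Set (SurfaceGroup g)} (hS : H g S) (u : SurfaceGroup g) : u • S ≠ Sᶜ := by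
  obtain ⟨y, b, rfl⟩ := hS
  rw [smul_E, E_compl]
  intro h
  exact inv_ne b (E_eq hg _ _ _ _ h).1.symm

end

/-- half-spaces separating -/
def sep (g : ℕ) (x y : SurfaceGroup g) : Set (Set (SurfaceGroup g)) := {S | H g S ∧ x ∉ S ∧ y ∈ S}

lemma mem_sep {g : ℕ} {x y : SurfaceGroup g} {S} : S ∈ sep g x y ↔ H g S ∧ x ∉ S ∧ y ∈ S := Iff.rfl

/-- distance -/
noncomputable def d (g : ℕ) (x y : SurfaceGroup g) : ℕ := (sep g x y).ncard

lemma sep_smul (g : ℕ) (u x y : SurfaceGroup g) : sep g (u * x) (u * y) = (fun S => u • S) '' sep g x y := by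
  ext S
  constructor
  · rintro ⟨h1, h2, h3⟩
    refine ⟨u⁻¹ • S, ⟨H_smul h1 _, ?_, ?_⟩, by simp⟩
    · rwa [mem_tr, inv_inv]
    · rwa [mem_tr, inv_inv]
  · rintro ⟨S, ⟨h1, h2, h3⟩, rfl⟩
    refine ⟨H_smul h1 _, ?_, ?_⟩
    · rw [mem_tr]; simpa using h2
    · rw [mem_tr]; simpa using h3

lemma d_smul (g : ℕ) (u x y : SurfaceGroup g) : d g (u * x) (u * y) = d g x y := by
  unfold d; rw [sep_smul, Set.ncard_image_of_injective]
  exact MulAction.injective u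

lemma sep_compl (g : ℕ) (x y : SurfaceGroup g) : sep g y x = (fun S => Sᶜ) '' sep g x y := by
  ext S
  constructor
  · rintro ⟨h1, h2, h3⟩
    exact ⟨Sᶜ, ⟨H_compl h1, by simpa using h3, h2⟩, by simp⟩
  · rintro ⟨S, ⟨h1, h2, h3⟩, rfl⟩
    exact ⟨H_compl h1, by simpa using h3, h2⟩

lemma d_symm (g : ℕ) (x y : SurfaceGroup g) : d g y x = d g x y := by
  unfold d; rw [sep_compl, Set.ncard_image_of_injective]
  exact compl_injective

lemma sep_self (g : ℕ) (x : SurfaceGroup g) : sep g x x = ∅ := by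
  ext S; simp [sep]

section

lemma sep_step {g : ℕ} (hg : 0 < g) (x z : SurfaceGroup g) (a) (h : z ∈ E g x a) :
    sep g x z = insert (E g x a) (sep g (x * evalLetter g a) z) ∧ E g x a ∉ sep g (x * evalLetter g a) z := by
  constructor
  · ext S
    constructor
    · rintro ⟨h1, h2, h3⟩
      by_cases h4 : x * evalLetter g a ∈ S
      · left; exact H_enter hg h1 x a h2 h4
      · right; exact ⟨h1, h4, h3⟩
    · rintro (rfl | ⟨h1, h2, h3⟩)
      · exact ⟨H_E _ _, notMem_E hg _ _, h⟩
      · refine ⟨h1, ?_, h3⟩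
        intro h4
        have := H_exit hg h1 x a h4 h2
        rw [← this] at h; exact h h3
  · rintro ⟨-, h1, -⟩; exact h1 (mem_E hg x a)

lemma sep_sub {g : ℕ} (hg : 0 < g) (x z : SurfaceGroup g) (a) :
    sep g x z ⊆ insert (E g x a) (sep g (x * evalLetter g a) z) := by
  rintro S ⟨h1, h2, h3⟩
  by_cases h4 : x * evalLetter g a ∈ S
  · left; exact H_enter hg h1 x a h2 h4
  · right; exact ⟨h1, h4, h3⟩

lemma sep_finite {g : ℕ} (hg : 0 < g) (x z : SurfaceGroup g) : (sep g x z).Finite := by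
  obtain ⟨w, hw⟩ := eval_surj g (x⁻¹ * z)
  obtain rfl : z = x * eval g w := by rw [hw]; simp
  clear hw
  induction w generalizing x with
  | nil => rw [eval_nil, mul_one, sep_self]; exact Set.finite_empty
  | cons a w ih =>
    refine Set.Finite.subset ?_ (sep_sub hg x _ a)
    rw [eval_cons, ← mul_assoc]
    exact (ih _).insert _

lemma d_le {g : ℕ} (hg : 0 < g) (x : SurfaceGroup g) (w) : d g x (x * eval g w) ≤ w.length := by
  induction w generalizing x with
  | nil => rw [eval_nil, mul_one, d, sep_self]; simp
  | cons a w ih =>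
    refine (Set.ncard_le_ncard (sep_sub hg x _ a) ((sep_finite hg _ _).insert _)).trans ?_
    refine (Set.ncard_insert_le _ _).trans ?_
    rw [eval_cons, ← mul_assoc]
    simpa [d] using ih (x * evalLetter g a)

lemma d_step {g : ℕ} (hg : 0 < g) (x z : SurfaceGroup g) (a) (h : z ∈ E g x a) :
    d g x z = d g (x * evalLetter g a) z + 1 := by
  unfold d
  rw [(sep_step hg x z a h).1, Set.ncard_insert_of_notMem (sep_step hg x z a h).2 (sep_finite hg _ _)]

lemma enter_word {g : ℕ} (hg : 0 < g) {S : Set (SurfaceGroup g)} (hS : H g S) (w : Word g) (x) (h1 : x ∉ S)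
    (h2 : x * eval g w ∈ S) : ∃ w1 b w2, w = w1 ++ b :: w2 ∧ S = E g (x * eval g w1) b := by
  induction w generalizing x with
  | nil => rw [eval_nil, mul_one] at h2; exact absurd h2 h1
  | cons a w ih =>
    by_cases h : x * evalLetter g a ∈ S
    · exact ⟨[], a, w, rfl, by rw [eval_nil, mul_one]; exact H_enter hg hS x a h1 h⟩
    · rw [eval_cons, ← mul_assoc] at h2
      obtain ⟨w1, b, w2, rfl, h4⟩ := ih _ h h2
      exact ⟨a :: w1, b, w2, rfl, by rw [eval_cons, ← mul_assoc]; exact h4⟩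

/-- single-signed words -/
def SS {g : ℕ} (w : Word g) : Prop := ∀ a ∈ w, invLetter g a ∉ w

lemma SS_first {g : ℕ} (hg : 0 < g) (a : Letter g) (w : Word g) (h : SS (a :: w)) (x : SurfaceGroup g) :
    x * eval g (a :: w) ∈ E g x a := by
  by_contra h1
  have h2 : x * evalLetter g a ∉ (E g x a)ᶜ := by simpa using mem_E hg x a
  rw [eval_cons, ← mul_assoc] at h1
  obtain ⟨w1, b, w2, rfl, h4⟩ := enter_word hg (H_compl (H_E x a)) w _ h2 h1
  rw [E_compl] at h4
  have h5 := (E_eq hg _ _ _ _ h4).1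
  refine h a (by simp) ?_
  rw [h5]; simp

lemma SS_d {g : ℕ} (hg : 0 < g) (w : Word g) (h : SS w) (x : SurfaceGroup g) : d g x (x * eval g w) = w.length := by
  induction w generalizing x with
  | nil => rw [eval_nil, mul_one, d, sep_self]; simp
  | cons a w ih =>
    rw [d_step hg x _ a (SS_first hg a w h x), eval_cons, ← mul_assoc, ih]
    · simp
    · intro b hb hb'
      exact h b (by simp [hb]) (by simp [hb'])

lemma SS_pow {g : ℕ} (v : Word g) (h : SS v) (k : ℤ) :
    ∃ w : Word g, SS w ∧ eval g w = eval g v ^ k ∧ w.length = k.natAbs * v.length ∧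
      (0 < k → ∃ v', w = v ++ v') := by
  have hn : ∀ v : Word g, SS v → ∀ k : ℕ, ∃ w : Word g, (∀ a ∈ w, a ∈ v) ∧ eval g w = eval g v ^ k ∧
     w.length = k * v.length ∧ (0 < k → ∃ v', w = v ++ v')  := by
    intro v h k
    induction k with
    | zero => exact ⟨[], by simp, by simp [eval_nil], by simp, by simp⟩
    | succ k ih =>
      obtain ⟨w, h1, h2, h3, -⟩ := ih
      refine ⟨v ++ w, ?_, ?_, ?_, fun _ => ⟨w, rfl⟩⟩
      · intro a ha
        rcases List.mem_append.1 ha with ha | ha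
        exacts [ha, h1 a ha]
      · rw [eval_append, h2, pow_succ']
      · rw [List.length_append, h3]; ring
  have hsub : ∀ v w : Word g, SS v → (∀ a ∈ w, a ∈ v) → SS w := by
    intro v w h h1 a ha hb
    exact h a (h1 a ha) (h1 _ hb)
  obtain ⟨k, rfl | rfl⟩ := k.eq_nat_or_neg
  · obtain ⟨w, h1, h2, h3, h4⟩ := hn v h k
    refine ⟨w, hsub v w h h1, by simpa using h2, by simpa using h3, fun hk => h4 (by omega)⟩
  · have hv : SS (wordInv g v) := by
      intro a ha hb
      simp only [wordInv, List.mem_reverse, List.mem_map] at ha hb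
      obtain ⟨b, hb1, rfl⟩ := ha
      obtain ⟨c, hc1, hc⟩ := hb
      apply h b hb1
      rw [invLetter_inv] at hc
      rw [← hc, invLetter_inv]; exact hc1
    obtain ⟨w, h1, h2, h3, h4⟩ := hn _ hv k
    refine ⟨w, hsub _ w hv h1, ?_, ?_, fun hk => by omega⟩
    · rw [h2, eval_wordInv]; simp
    · rw [h3]; simp [wordInv]

lemma eval_seg {g : ℕ} (hg : 0 < g) (s n : ℕ) : eval g (seg g (L g hg) s n) = (Y g s)⁻¹ * Y g (s + n) := by
  induction n with
  | zero => simp [seg, eval_nil]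
  | succ n ih =>
    have : seg g (L g hg) s (n+1) = seg g (L g hg) s n ++ [L g hg (s+n)] := by
      simp [seg, List.range_succ]
    rw [this, eval_append, ih, eval_cons, eval_nil, ← Nat.add_assoc, Y_succ g hg]
    simp [mul_assoc]

lemma SS_seg {g : ℕ} (hg : 0 < g) (s n : ℕ) (hn : n ≤ 2*g) : SS (seg g (L g hg) s n) := by
  intro a ha hb
  simp only [seg, List.mem_map, List.mem_range] at ha hb
  obtain ⟨j, hj, rfl⟩ := ha
  obtain ⟨j', hj', h⟩ := hb
  have h1 := congrArg (fun p => (p.1 : ℕ)) h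
  simp only [L, invLetter] at h1
  have h2 : j' ≡ j [MOD 2*g] := Nat.ModEq.add_left_cancel' s h1
  have h3 := Nat.ModEq.eq_of_lt_of_lt h2 (by omega) (by omega)
  subst h3
  exact inv_ne _ h.symm

lemma Y_inv {g : ℕ} (hg : 0 < g) (i : Fin (2*g)) : Y g (i + 2*g + 1) = Y g (i+2*g) * (gen g i)⁻¹ := by
  rw [Y_succ g hg]
  have : L g hg (i + 2*g) = (i, false) := by
    unfold L
    have := i.2
    rw [Nat.add_div_right _ (by omega)]
    ext
    · simp [Nat.mod_eq_of_lt this]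
    · simp [Nat.div_eq_of_lt this]
  rw [this]; rfl

lemma Y_fwd {g : ℕ} (hg : 0 < g) (i : Fin (2*g)) : Y g (i + 1) = Y g i * gen g i := by
  rw [Y_succ g hg]
  have : L g hg i = (i, true) := by
    unfold L
    have := i.2
    ext
    · simp [Nat.mod_eq_of_lt this]
    · simp [Nat.div_eq_of_lt this]
  rw [this]; rfl

lemma A_word {g : ℕ} (hg : 0 < g) (a : Letter g) (k : ℤ) : ∃ w : Word g, SS w ∧ eval g w = A g a ^ k ∧
    w.length = k.natAbs * (2*g-1) := by
  rcases a with ⟨i, _ | _⟩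
  · obtain ⟨w, h1, h2, h3, -⟩ := SS_pow _ (SS_seg hg (i+1) (2*g-1) (by omega)) (-k)
    refine ⟨w, h1, ?_, by simpa [seg] using h3⟩
    rw [h2, eval_seg, show (i:ℕ)+1+(2*g-1) = i+2*g by omega, zpow_neg, ← inv_zpow]
    congr 1
    simp only [A, tt, Y_inv hg, Y_fwd hg]
    simp [mul_assoc]
  · obtain ⟨w, h1, h2, h3, -⟩ := SS_pow _ (SS_seg hg (i+2*g+1) (2*g-1) (by omega)) (k)
    refine ⟨w, h1, ?_, by simpa [seg] using h3⟩
    rw [h2, eval_seg, show (i:ℕ)+2*g+1+(2*g-1) = i+4*g by omega, Y_add g hg]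
    congr 1
    simp [A, tt]

lemma A_conj {g : ℕ} (a : Letter g) (k : ℤ) :
    evalLetter g a * A g (invLetter g a) ^ k * (evalLetter g a)⁻¹ = A g a ^ k := by
  rw [← conj_zpow]
  congr 1
  rcases a with ⟨i, _ | _⟩ <;> simp [A, invLetter, evalLetter, mul_assoc]

/-- geodesic words -/
def Geo (g : ℕ) (w : Word g) : Prop := w.length = len g (eval g w)

lemma len_le' {g : ℕ} (w : Word g) (x) (h : eval g w = x) : len g x ≤ w.length := h ▸ len_le g w

lemma Geo_infix {g : ℕ} (hg : 0 < g) (w1 w2 w3 : Word g) (h : Geo g (w1 ++ (w2 ++ w3))) : Geo g w2 := by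
  unfold Geo at *
  apply le_antisymm _ (len_le g w2)
  obtain ⟨w, hw1, hw2⟩ := exists_len g (eval g w2)
  have : eval g (w1 ++ (w ++ w3)) = eval g (w1 ++ (w2 ++ w3)) := by
    simp [eval_append, hw2]
  have h2 := len_le' _ _ this
  rw [← h] at h2
  simp at h2
  omega

lemma F1_aux {g : ℕ} (hg : 0 < g) (n : ℕ) : ∀ w : Word g, w.length = n → Geo g w → 
    (∀ a w', w = a :: w' → eval g w ∈ E g 1 a) ∧ d g 1 (eval g w) = w.length := by
  induction n using Nat.strong_induction_on with
  | _ n ih =>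
  intro w hw hgeo
  rcases w with _ | ⟨a, w'⟩
  · refine ⟨by simp, ?_⟩
    rw [eval_nil, d, sep_self]; simp
  have hgeo' : Geo g w' := by
    have := Geo_infix hg [a] w' [] (by simpa using hgeo)
    exact this
  have key : eval g (a :: w') ∈ E g 1 a := by
    by_contra h1
    have h2 : evalLetter g a ∉ (E g 1 a)ᶜ := by
      have := mem_E hg 1 a
      rw [one_mul] at this
      simpa using this
    rw [eval_cons] at h1
    obtain ⟨w1, b, w2, rfl, h4⟩ := enter_word hg (H_compl (H_E 1 a)) w' _ h2 h1
    rw [E_compl, one_mul] at h4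
    obtain ⟨rfl, h5⟩ := E_eq hg _ _ _ _ h4
    rw [inv_mul_cancel_left] at h5
    obtain ⟨k, hk⟩ := Subgroup.mem_zpowers_iff.1 h5
    have hg1 : Geo g w1 := Geo_infix hg [] w1 _ hgeo'
    simp only [List.length_cons, List.length_append] at hw
    have h6 := (ih w1.length (by omega) w1 rfl hg1).2
    obtain ⟨r, hr1, hr2, hr3⟩ := A_word hg (invLetter g a) k
    have h7 := SS_d hg r hr1 1
    rw [one_mul, hr2, hk] at h7
    obtain ⟨s, hs1, hs2, hs3⟩ := A_word hg a k
    have h8 : eval g (s ++ w2) = eval g (a :: (w1 ++ invLetter g a :: w2)) := by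
      simp only [eval_cons, eval_append]
      rw [hs2, ← A_conj, hk, evalLetter_inv]
      simp [mul_assoc]
    have h9 := len_le' _ _ h8
    rw [← hgeo] at h9
    simp only [List.length_cons, List.length_append] at h9
    omega
  refine ⟨?_, ?_⟩
  · intro b w'' h
    obtain ⟨rfl, rfl⟩ := List.cons.inj h
    exact key
  · simp only [List.length_cons] at hw
    rw [d_step hg 1 _ a key, eval_cons, one_mul]
    have := (ih w'.length (by omega) w' rfl hgeo').2
    have h2 := d_smul g (evalLetter g a) 1 (eval g w')
    rw [mul_one] at h2
    rw [h2, this]; rfl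

theorem len_eq_d {g : ℕ} (hg : 0 < g) (x : SurfaceGroup g) : len g x = d g 1 x := by
  obtain ⟨w, h1, rfl⟩ := exists_len g x
  rw [(F1_aux hg _ w rfl h1).2, h1]

lemma exists_edge {g : ℕ} (hg : 0 < g) {S S' : Set (SurfaceGroup g)} (hS' : H g S') (x y : SurfaceGroup g)
    (h1 : x ∉ S) (h2 : y ∈ S) (h3 : x ∈ S') (h4 : y ∈ S') :
    ∃ z a, z ∈ S' ∧ z * evalLetter g a ∈ S' ∧ z ∉ S ∧ z * evalLetter g a ∈ S := by
  obtain ⟨w, hw1, hw2⟩ := exists_len g (x⁻¹ * y)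
  have hgeo : Geo g w := by unfold Geo; rw [hw2, hw1]
  clear hw1
  induction w generalizing x with
  | nil =>
    rw [eval_nil] at hw2
    obtain rfl : x = y := by rw [eq_comm, inv_mul_eq_one] at hw2; exact hw2
    exact absurd h2 h1
  | cons a w ih =>
    have h5 := (F1_aux hg _ _ rfl hgeo).1 a w rfl
    have h6 : y ∈ E g x a := by
      have : x⁻¹ * y ∈ x⁻¹ • E g x a := by rw [smul_E, inv_mul_cancel, ← hw2]; exact h5
      rw [mem_tr] at this; simpa using this
    have h7 : x * evalLetter g a ∈ S' := by
      by_contra h7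
      have := H_exit hg hS' x a h3 h7
      rw [← this] at h6; exact h6 h4
    by_cases h8 : x * evalLetter g a ∈ S
    · exact ⟨x, a, h3, h7, h1, h8⟩
    · refine ih _ h8 h7 ?_ (Geo_infix hg [a] w [] (by simpa using hgeo))
      rw [mul_inv_rev, mul_assoc, ← hw2, eval_cons]; simp

end
end SGP

namespace SGP
open SG
open scoped Pointwise

section hom3
variable {K : Type*} [Group K]

/-- three-generator assignment -/
def f3 (r s k : ℕ) (a b c : K) (l : ℕ) : K := if l = r then a else if l = s then b else if l = k then c else 1

/-- prefix products of `f3` -/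
def p3 (r s k : ℕ) (a b c : K) (l : ℕ) : K :=
  if l ≤ r then 1 else if l ≤ s then a else if l ≤ k then a * b else a * b * c

lemma Z_f3 (g r s k : ℕ) (a b c : K) (h1 : r < s) (h2 : s < k) (m : ℕ) (hm : m ≤ 2*g) :
    Z g (f3 r s k a b c) m = p3 r s k a b c m := by
  induction m with
  | zero => simp [Z, p3]
  | succ m ih =>
    rw [Z_succ, ih (by omega), cw_lt _ _ _ (by omega)]
    unfold f3 p3
    split_ifs <;> first | omega | simp

lemma Z_f3' (g r s k : ℕ) (hg : 0 < g) (a b c : K) (h1 : r < s) (h2 : s < k) (h3 : k < 2*g) (m : ℕ) (hm : m ≤ 2*g) :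
    Z g (f3 r s k a b c) (m + 2*g) = a * b * c * p3 r s k a⁻¹ b⁻¹ c⁻¹ m := by
  induction m with
  | zero =>
    rw [Nat.zero_add, Z_f3 _ _ _ _ _ _ _ h1 h2 _ le_rfl]
    unfold p3
    split_ifs <;> first | omega | simp
  | succ m ih =>
    rw [show m+1+2*g = (m+2*g)+1 by omega, Z_succ, ih (by omega), cw_add _ hg, cw_lt _ _ _ (by omega), mul_assoc]
    congr 1
    unfold f3 p3
    split_ifs <;> first | omega | simp

theorem exists_hom3 (g r s k : ℕ) (hg : 0 < g) (a b c : K) (h1 : r < s) (h2 : s < k) (h3 : k < 2*g)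
    (h : a * b * c = c * b * a) : ∃ φ : SurfaceGroup g →* K,
      (∀ i : Fin (2*g), φ (gen g i) = f3 r s k a b c i) ∧
      ∀ i : Fin (2*g), φ (tt g i) =
        p3 r s k a b c i * (a * b * c * p3 r s k a⁻¹ b⁻¹ c⁻¹ (i+1))⁻¹ := by
  have hz : Z g (f3 r s k a b c) (4*g) = 1 := by
    rw [show 4*g = 2*g+2*g by omega, Z_f3' g r s k hg a b c h1 h2 h3 _ le_rfl, h]
    unfold p3
    split_ifs <;> first | omega | simp [mul_assoc]
  obtain ⟨φ, hφ, hφ2⟩ := exists_hom g hg _ hz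
  refine ⟨φ, hφ, fun i => ?_⟩
  have := i.2
  unfold tt
  rw [map_mul, map_inv, hφ2, hφ2, Z_f3 _ _ _ _ _ _ _ h1 h2 _ (by omega),
    show (i:ℕ)+2*g+1 = (i+1)+2*g by omega, Z_f3' g r s k hg a b c h1 h2 h3 _ (by omega)]

end hom3

theorem exists_AB : ∃ (K : Type) (_ : Group K) (A B : K),
    ∀ m b b' n : ℤ, A^m * B^b = B^b' * A^n → m = 0 ∨ b = 0 := by
  refine ⟨Matrix.SpecialLinearGroup (Fin 2) ℤ, inferInstance, ModularGroup.T,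
    ModularGroup.S * ModularGroup.T * ModularGroup.S⁻¹, fun m b b' n h => ?_⟩
  rw [conj_zpow, conj_zpow] at h
  have h1 := congrArg (fun M : Matrix.SpecialLinearGroup (Fin 2) ℤ => (M : Matrix (Fin 2) (Fin 2) ℤ) 0 0) h
  simp only [Matrix.SpecialLinearGroup.coe_mul, Matrix.SpecialLinearGroup.coe_inv,
    ModularGroup.coe_T_zpow, ModularGroup.coe_S, Matrix.adjugate_fin_two] at h1
  simp at h1
  exact h1

lemma tt_rel_lt {g : ℕ} (hg : 2 ≤ g) (i j : Fin (2*g)) (hij : i < j) (m b b' n : ℤ)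
    (h : tt g i ^ m * tt g j ^ b = tt g j ^ b' * tt g i ^ n) : m = 0 ∨ b = 0 := by
  obtain ⟨K, _, A, B, hAB⟩ := exists_AB
  suffices hh : ∃ φ : SurfaceGroup g →* K, φ (tt g i) = A ∧ φ (tt g j) = B by
    obtain ⟨φ, h1, h2⟩ := hh
    have := congrArg φ h
    simp only [map_mul, map_zpow, h1, h2] at this
    exact hAB _ _ _ _ this
  have hi := i.2
  have hj := j.2
  have hij' : (i:ℕ) < j := hij
  by_cases c1 : (j:ℕ) = 2*g-1
  · by_cases c2 : (i:ℕ) = 0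
    · obtain ⟨φ, -, hφ⟩ := exists_hom3 g 0 1 2 (by omega) (A*B) (A*B)⁻¹ B (by omega) (by omega) (by omega)
        (by simp)
      refine ⟨φ, ?_, ?_⟩ <;> rw [hφ] <;> unfold p3 <;> split_ifs <;> first | omega | simp [mul_assoc]
    · by_cases c3 : (i:ℕ) = 1
      · obtain ⟨φ, -, hφ⟩ := exists_hom3 g 0 2 (2*g-1) (by omega) (A*B) (B⁻¹*A⁻¹*B) (A*B) (by omega)
          (by omega) (by omega) (by simp [mul_assoc])
        refine ⟨φ, ?_, ?_⟩ <;> rw [hφ] <;> unfold p3 <;> split_ifs <;> first | omega | simp [mul_assoc]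
      · obtain ⟨φ, -, hφ⟩ := exists_hom3 g 0 1 (2*g-1) (by omega) (A⁻¹*B) (B⁻¹*A*B) (A⁻¹*B) (by omega)
          (by omega) (by omega) (by simp [mul_assoc])
        refine ⟨φ, ?_, ?_⟩ <;> rw [hφ] <;> unfold p3 <;> split_ifs <;> first | omega | simp [mul_assoc]
  · by_cases c2 : (i:ℕ) = 0
    · by_cases c3 : (j:ℕ) = 2*g-2
      · obtain ⟨φ, -, hφ⟩ := exists_hom3 g 0 1 (2*g-1) (by omega) (A*B⁻¹) (A*B⁻¹)⁻¹ (B⁻¹) (by omega)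
          (by omega) (by omega) (by simp)
        refine ⟨φ, ?_, ?_⟩ <;> rw [hφ] <;> unfold p3 <;> split_ifs <;> first | omega | simp [mul_assoc]
      · obtain ⟨φ, -, hφ⟩ := exists_hom3 g 0 (2*g-2) (2*g-1) (by omega) (B*A⁻¹) (B*A⁻¹)⁻¹ (A⁻¹*B*A⁻¹)
          (by omega) (by omega) (by omega) (by simp [mul_assoc])
        refine ⟨φ, ?_, ?_⟩ <;> rw [hφ] <;> unfold p3 <;> split_ifs <;> first | omega | simp [mul_assoc]
    · obtain ⟨φ, -, hφ⟩ := exists_hom3 g (i-1) j (j+1) (by omega) (A*B⁻¹) (A*B⁻¹)⁻¹ (B⁻¹*A*B⁻¹)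
          (by omega) (by omega) (by omega) (by simp [mul_assoc])
      refine ⟨φ, ?_, ?_⟩ <;> rw [hφ] <;> unfold p3 <;> split_ifs <;> first | omega | simp [mul_assoc]

lemma tt_rel {g : ℕ} (hg : 2 ≤ g) (i j : Fin (2*g)) (hij : i ≠ j) (m b b' n : ℤ)
    (h : tt g i ^ m * tt g j ^ b = tt g j ^ b' * tt g i ^ n) : m = 0 ∨ b = 0 := by
  rcases lt_or_gt_of_ne hij with h1 | h1
  · exact tt_rel_lt hg i j h1 m b b' n h
  · have := tt_rel_lt hg j i h1 (-b) (-m) (-n) (-b') (by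
      have := congrArg (fun x => x⁻¹) h
      simpa using this)
    omega

/-- crossing -/
def Cr {G : Type*} (S S' : Set G) : Prop :=
  (∃ x, x ∈ S ∧ x ∈ S') ∧ (∃ x, x ∈ S ∧ x ∉ S') ∧ (∃ x, x ∉ S ∧ x ∈ S') ∧ (∃ x, x ∉ S ∧ x ∉ S')

lemma Cr_symm {G : Type*} {S S' : Set G} (h : Cr S S') : Cr S' S := by
  unfold Cr at *; tauto
lemma Cr_compl {G : Type*} {S S' : Set G} : Cr S S'ᶜ ↔ Cr S S' := by
  unfold Cr; simp only [Set.mem_compl_iff, not_not]; tauto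
lemma Cr_compl' {G : Type*} {S S' : Set G} : Cr Sᶜ S' ↔ Cr S S' := by
  unfold Cr; simp only [Set.mem_compl_iff, not_not]; tauto

/-- normalized half-space -/
def Wl (g : ℕ) (i : Fin (2*g)) (h : SurfaceGroup g) : Set (SurfaceGroup g) := h • B g i

lemma Wl_eq_E (g : ℕ) (i : Fin (2*g)) (h : SurfaceGroup g) : Wl g i h = E g (h * Y g i) (i, true) := by
  simp [Wl, E]

lemma H_Wl (g : ℕ) (i : Fin (2*g)) (h : SurfaceGroup g) : H g (Wl g i h) := by
  rw [Wl_eq_E]; exact H_E _ _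

lemma Wl_T {g : ℕ} (hg : 0 < g) (i : Fin (2*g)) (h t : SurfaceGroup g) (ht : t ∈ T g i) :
    Wl g i (h * t) = Wl g i h := by
  ext x
  unfold Wl
  rw [mem_tr, mem_tr, mul_inv_rev, mul_assoc, B_T g hg i _ (inv_mem ht)]

lemma Wl_eq {g : ℕ} (hg : 0 < g) (i : Fin (2*g)) (h h' : SurfaceGroup g) (he : Wl g i h = Wl g i h') :
    ∃ k : ℤ, h' = h * tt g i ^ k := by
  have h1 : h' * Y g i ∉ Wl g i h := by
    rw [he, Wl_eq_E]; exact notMem_E hg _ _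
  have h2 : h' * Y g i * evalLetter g (i, true) ∈ Wl g i h := by
    rw [he, Wl_eq_E]; exact mem_E hg _ _
  unfold Wl at h1 h2
  rw [mem_tr] at h1 h2
  rw [← mul_assoc] at h2
  obtain ⟨-, h3⟩ := B_enter g hg i _ _ h1 h2
  obtain ⟨k, hk⟩ := Subgroup.mem_zpowers_iff.1 h3
  exact ⟨k, by rw [hk]; simp [mul_assoc]⟩

lemma Wl_enter {g : ℕ} (hg : 0 < g) (i : Fin (2*g)) (h z : SurfaceGroup g) (a) (h1 : z ∉ Wl g i h)
    (h2 : z * evalLetter g a ∈ Wl g i h) : ∃ k : ℤ, z = h * tt g i ^ k * Y g i := by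
  unfold Wl at h1 h2
  rw [mem_tr] at h1 h2
  rw [← mul_assoc] at h2
  obtain ⟨-, h3⟩ := B_enter g hg i _ _ h1 h2
  obtain ⟨k, hk⟩ := Subgroup.mem_zpowers_iff.1 h3
  exact ⟨k, by rw [hk]; simp [mul_assoc]⟩

lemma HS_Wl {g : ℕ} (i : Fin (2*g)) (S) (hS : HS g i S) : ∃ h, S = Wl g i h ∨ S = (Wl g i h)ᶜ := by
  obtain ⟨x, ⟨i, b⟩, rfl, rfl⟩ := hS
  rcases b with _ | _
  · exact ⟨x * (gen g i)⁻¹ * (Y g i)⁻¹, Or.inr rfl⟩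
  · exact ⟨x * (Y g i)⁻¹, Or.inl rfl⟩

lemma L_cases {g : ℕ} (hg : 0 < g) (l : ℕ) (hl : l < 4*g) :
    ∃ i : Fin (2*g), (l = i ∧ L g hg l = (i, true)) ∨ (l = i + 2*g ∧ L g hg l = (i, false)) := by
  by_cases h : l < 2*g
  · refine ⟨⟨l, h⟩, Or.inl ⟨rfl, ?_⟩⟩
    unfold L
    ext
    · simp [Nat.mod_eq_of_lt h]
    · simp [Nat.div_eq_of_lt h]
  · obtain ⟨k, rfl⟩ : ∃ k, l = k + 2*g := ⟨l-2*g, by omega⟩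
    have hk : k < 2*g := by omega
    refine ⟨⟨k, hk⟩, Or.inr ⟨rfl, ?_⟩⟩
    unfold L
    rw [Nat.add_div_right _ (by omega)]
    ext
    · simp [Nat.mod_eq_of_lt hk]
    · simp [Nat.div_eq_of_lt hk]

/-- edges of the polygon at `p` are dual to the walls `Wl j p` -/
lemma E_poly {g : ℕ} (hg : 0 < g) (p : SurfaceGroup g) (l : ℕ) (hl : l < 4*g) :
    ∃ j, E g (p * Y g l) (L g hg l) = Wl g j p ∨ (E g (p * Y g l) (L g hg l))ᶜ = Wl g j p := by
  obtain ⟨i, ⟨h1, h2⟩ | ⟨h1, h2⟩⟩ := L_cases hg l hl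
  · refine ⟨i, Or.inl ?_⟩
    rw [h2, Wl_eq_E, h1]
  · refine ⟨i, Or.inr ?_⟩
    rw [h2, h1, ← Wl_T hg i p _ (inv_mem (tt_mem g i))]
    unfold tt
    rw [Y_inv hg]
    simp [E, Wl, mul_assoc]

lemma Wl_ne {g : ℕ} (hg : 0 < g) (i j : Fin (2*g)) (h h' : SurfaceGroup g) :
    (Wl g i h ≠ (Wl g j h')ᶜ) ∧ (Wl g i h = Wl g j h' → i = j) := by
  rw [Wl_eq_E, Wl_eq_E, E_compl]
  constructor
  · intro h
    have := (E_eq hg _ _ _ _ h).1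
    simp [invLetter] at this
  · intro h
    have := (E_eq hg _ _ _ _ h).1
    simpa using this

lemma lemC {g : ℕ} (hg : 0 < g) (i j : Fin (2*g)) (h h' : SurfaceGroup g)
    (hc : Cr (Wl g i h) (Wl g j h')) : ∃ a b : ℤ, h' = h * tt g i ^ a * tt g j ^ b := by
  suffices hs : ∃ a : ℤ, Wl g j (h * tt g i ^ a) = Wl g j h' by
    obtain ⟨a, ha⟩ := hs
    obtain ⟨b, hb⟩ := Wl_eq hg _ _ _ ha
    exact ⟨a, b, hb⟩
  by_contra hn
  push Not at hn
  have hS := H_Wl g j h'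
  have hstep : ∀ (k : ℤ) (l : ℕ), l < 4*g → (h * tt g i ^ k * Y g (l+1) ∈ Wl g j h' ↔
      h * tt g i ^ k * Y g l ∈ Wl g j h') := by
    intro k l hl
    by_contra hne
    have hcase : Wl g j h' = E g (h * tt g i ^ k * Y g l) (L g hg l) ∨
       (Wl g j h')ᶜ = E g (h * tt g i ^ k * Y g l) (L g hg l) := by
      rw [Y_succ g hg, ← mul_assoc] at hne
      by_cases h1 : h * tt g i ^ k * Y g l ∈ Wl g j h'
      · right; exact H_exit hg hS _ _ h1 (by tauto)
      · left; exact H_enter hg hS _ _ h1 (by tauto)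
    obtain ⟨j', hj'⟩ := E_poly hg (h * tt g i ^ k) l hl
    have heq : Wl g j h' = Wl g j' (h * tt g i ^ k) := by
      rcases hcase with h1 | h1 <;> rcases hj' with h2 | h2
      · rw [h1, h2]
      · exact absurd (show Wl g j' (h * tt g i ^ k) = (Wl g j h')ᶜ by rw [h1, h2]) (Wl_ne hg _ _ _ _).1
      · exact absurd (show Wl g j' (h * tt g i ^ k) = (Wl g j h')ᶜ by rw [h1, h2]) (Wl_ne hg _ _ _ _).1
      · rw [← h2, ← h1, compl_compl]
    have := (Wl_ne hg _ _ _ _).2 heq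
    subst this
    exact hn k heq.symm
  have hl : ∀ (k : ℤ) (l : ℕ), l ≤ 4*g → (h * tt g i ^ k * Y g l ∈ Wl g j h' ↔
      h * tt g i ^ k * Y g 0 ∈ Wl g j h') := by
    intro k l hl
    induction l with
    | zero => rfl
    | succ l ih => rw [hstep k l (by omega), ih (by omega)]
  have hi := i.2
  have hk1 : ∀ k : ℤ, (h * tt g i ^ (k+1) * Y g 0 ∈ Wl g j h' ↔ h * tt g i ^ k * Y g 0 ∈ Wl g j h') := by
    intro k
    rw [← hl (k+1) (i + 2*g+1) (by omega), ← hl k i (by omega), zpow_add_one]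
    have : h * (tt g i ^ k * tt g i) * Y g (↑i + 2 * g + 1) = h * tt g i ^ k * Y g i := by
      simp [mul_assoc, tt]
    rw [this]
  have hk : ∀ k : ℤ, (h * tt g i ^ k * Y g i ∈ Wl g j h' ↔ h * tt g i ^ (0:ℤ) * Y g 0 ∈ Wl g j h') := by
    intro k
    rw [hl k i (by omega)]
    induction k using Int.induction_on with
    | zero => rfl
    | succ n ih => rw [hk1, ih]
    | pred n ih => rw [← ih, ← hk1]; simp
  obtain ⟨⟨x1, hx1, hx1'⟩, ⟨x2, hx2, hx2'⟩, ⟨x3, hx3, hx3'⟩, ⟨x4, hx4, hx4'⟩⟩ := hc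
  obtain ⟨z, a, hz1, -, hz2, hz3⟩ := exists_edge hg hS x3 x1 hx3 hx1 hx3' hx1'
  obtain ⟨z', a', hz1', -, hz2', hz3'⟩ := exists_edge hg (H_compl hS) x4 x2 hx4 hx2 hx4' hx2'
  obtain ⟨k, rfl⟩ := Wl_enter hg i h z a hz2 hz3
  obtain ⟨k', rfl⟩ := Wl_enter hg i h z' a' hz2' hz3'
  rw [hk] at hz1
  rw [Set.mem_compl_iff, hk] at hz1'
  exact hz1' hz1

lemma not_Cr_self {G : Type*} (S : Set G) : ¬ Cr S S := by
  rintro ⟨-, ⟨x, h1, h2⟩, -⟩; exact h2 h1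

/-- no crossing of same type -/
lemma not_Cr_same {g : ℕ} (hg : 0 < g) (i : Fin (2*g)) (S S') (hS : HS g i S) (hS' : HS g i S') :
    ¬ Cr S S' := by
  intro hc
  obtain ⟨h, hh⟩ := HS_Wl i S hS
  obtain ⟨h', hh'⟩ := HS_Wl i S' hS'
  have : Cr (Wl g i h) (Wl g i h') := by
    rcases hh with rfl | rfl <;> rcases hh' with rfl | rfl <;> simpa only [Cr_compl, Cr_compl'] using hc
  obtain ⟨a, b, rfl⟩ := lemC hg i i h h' this
  rw [mul_assoc, Wl_T hg] at this
  · exact not_Cr_self _ this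
  · exact mul_mem (Subgroup.zpow_mem _ (tt_mem g i) _) (Subgroup.zpow_mem _ (tt_mem g i) _)

lemma lemQ {g : ℕ} (hg : 2 ≤ g) (i j : Fin (2*g)) (V1 V2 W1 W2) (h1 : HS g i V1) (h2 : HS g i V2)
    (h3 : HS g j W1) (h4 : HS g j W2) (c11 : Cr V1 W1) (c21 : Cr V2 W1) (c12 : Cr V1 W2)
    (c22 : Cr V2 W2) : V1 = V2 ∨ V1 = V2ᶜ ∨ W1 = W2 ∨ W1 = W2ᶜ := by
  have hg0 : 0 < g := by omega
  by_cases hij : i = j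
  · subst hij
    exact absurd c11 (not_Cr_same hg0 i _ _ h1 h3)
  obtain ⟨p1, hp1⟩ := HS_Wl i V1 h1
  obtain ⟨p2, hp2⟩ := HS_Wl i V2 h2
  obtain ⟨q1, hq1⟩ := HS_Wl j W1 h3
  obtain ⟨q2, hq2⟩ := HS_Wl j W2 h4
  have key : ∀ (i j : Fin (2*g)) (V W) (p q), (V = Wl g i p ∨ V = (Wl g i p)ᶜ) →
     (W = Wl g j q ∨ W = (Wl g j q)ᶜ) → Cr V W → ∃ a b : ℤ, q = p * tt g i ^ a * tt g j ^ b := by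
    intro i j V W p q hp hq hc
    apply lemC hg0 i j p q
    rcases hp with rfl | rfl <;> rcases hq with rfl | rfl <;> simpa only [Cr_compl, Cr_compl'] using hc
  obtain ⟨a1, b1, e1⟩ := key i j _ _ _ _ hp1 hq1 c11
  obtain ⟨a2, b2, e2⟩ := key i j _ _ _ _ hp2 hq1 c21
  obtain ⟨a3, b3, e3⟩ := key i j _ _ _ _ hp2 hq2 c22
  obtain ⟨a4, b4, e4⟩ := key i j _ _ _ _ hp1 hq2 c12
  have e5 : p2 = p1 * (tt g i ^ a1 * tt g j ^ (b1 - b2) * tt g i ^ (-a2)) := by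
    have : p2 = q1 * tt g j ^ (-b2) * tt g i ^ (-a2) := by rw [e2]; simp [mul_assoc]
    rw [this, e1, zpow_sub]; simp [mul_assoc]
  have e6 : p2 = p1 * (tt g i ^ a4 * tt g j ^ (b4 - b3) * tt g i ^ (-a3)) := by
    have : p2 = q2 * tt g j ^ (-b3) * tt g i ^ (-a3) := by rw [e3]; simp [mul_assoc]
    rw [this, e4, zpow_sub]; simp [mul_assoc]
  have e7 := mul_left_cancel (e5.symm.trans e6)
  have e8 : tt g i ^ (a1 - a4) * tt g j ^ (b1 - b2) = tt g j ^ (b4 - b3) * tt g i ^ (a2 - a3) := by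
    have : tt g i ^ (a1 - a4) * tt g j ^ (b1 - b2) =
      tt g i ^ (-a4) * (tt g i ^ a1 * tt g j ^ (b1 - b2) * tt g i ^ (-a2)) * tt g i ^ a2 := by
      rw [sub_eq_neg_add a1 a4, zpow_add]; simp [mul_assoc]
    rw [this, e7, sub_eq_neg_add a2 a3, zpow_add]; simp [mul_assoc]
  have gen : ∀ (P Q : Set (SurfaceGroup g)) (X : Set (SurfaceGroup g)), (P = X ∨ P = Xᶜ) → (Q = X ∨ Q = Xᶜ) →
      P = Q ∨ P = Qᶜ := by
    rintro P Q X (rfl | rfl) (rfl | rfl) <;> simp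
  rcases tt_rel hg i j hij _ _ _ _ e8 with h | h
  · right; right
    have e : a1 = a4 := by omega
    have : Wl g j q1 = Wl g j q2 := by
      rw [e1, e4, Wl_T hg0 _ _ _ (Subgroup.zpow_mem _ (tt_mem g j) _),
        Wl_T hg0 _ _ _ (Subgroup.zpow_mem _ (tt_mem g j) _), e]
    rw [← this] at hq2
    exact gen _ _ _ hq1 hq2
  · have : Wl g i p1 = Wl g i p2 := by
      rw [h, zpow_zero, mul_one] at e5
      rw [e5, Wl_T hg0]
      exact mul_mem (Subgroup.zpow_mem _ (tt_mem g i) _) (Subgroup.zpow_mem _ (tt_mem g i) _)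
    rw [← this] at hp2
    rcases gen _ _ _ hp1 hp2 with h | h
    · left; exact h
    · right; left; exact h

end SGP

namespace SGP
open SG
open scoped Pointwise

lemma smul_ssub {G : Type*} [Group G] {a : G} {S T : Set G} : a • S ⊂ a • T ↔ S ⊂ T := by
  rw [ssubset_iff_subset_not_subset, ssubset_iff_subset_not_subset, Set.smul_set_subset_smul_set_iff,
    Set.smul_set_subset_smul_set_iff]

lemma compl_ssub {G : Type*} {S T : Set G} : Sᶜ ⊂ Tᶜ ↔ T ⊂ S := by
  rw [ssubset_iff_subset_not_subset, ssubset_iff_subset_not_subset, Set.compl_subset_compl,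
    Set.compl_subset_compl]

/-- half-spaces pushed inside themselves -/
def PP (g : ℕ) (u : SurfaceGroup g) : Set (Set (SurfaceGroup g)) := {S | H g S ∧ u • S ⊂ S}

/-- number of skewered half-spaces -/
noncomputable def np (g : ℕ) (u x y : SurfaceGroup g) : ℕ := (sep g x y ∩ PP g u).ncard

/-- signed count -/
noncomputable def ee (g : ℕ) (u x y : SurfaceGroup g) : ℤ := (np g u x y : ℤ) - np g u y x

open Classical in
lemma ee_sum {g : ℕ} (u x y : SurfaceGroup g) (F : Finset (Set (SurfaceGroup g)))
    (hF : ∀ S ∈ F, S ∈ PP g u) (h1 : sep g x y ∩ PP g u ⊆ F) (h2 : sep g y x ∩ PP g u ⊆ F) :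
    ee g u x y = ∑ S ∈ F, ((if y ∈ S then 1 else 0) - (if x ∈ S then 1 else 0) : ℤ) := by
  have key : ∀ x y, sep g x y ∩ PP g u ⊆ F → (np g u x y : ℤ) = ∑ S ∈ F, (if x ∉ S ∧ y ∈ S then 1 else 0 : ℤ) := by
    intro x y h
    have : sep g x y ∩ PP g u = ((F.filter (fun S => x ∉ S ∧ y ∈ S) : Finset _) : Set (Set (SurfaceGroup g))) := by
      ext S
      simp only [Finset.coe_filter, Set.mem_ofPred_eq]
      constructor
      · rintro hS; exact ⟨h hS, hS.1.2⟩
      · rintro ⟨h3, h4⟩; exact ⟨⟨(hF S h3).1, h4⟩, hF S h3⟩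
    unfold np
    rw [this, Set.ncard_coe_finset, Finset.card_filter]
    push_cast; rfl
  unfold ee
  rw [key x y h1, key y x h2, ← Finset.sum_sub_distrib]
  apply Finset.sum_congr rfl
  intro S _
  by_cases hx : x ∈ S <;> by_cases hy : y ∈ S <;> simp [hx, hy]

lemma ee_add {g : ℕ} (hg : 0 < g) (u x y z : SurfaceGroup g) :
    ee g u x z = ee g u x y + ee g u y z := by
  have hf : ∀ a b, (sep g a b ∩ PP g u).Finite := fun a b => (sep_finite hg a b).inter_of_left _
  set U := (sep g x y ∩ PP g u) ∪ (sep g y x ∩ PP g u) ∪ ((sep g y z ∩ PP g u) ∪ (sep g z y ∩ PP g u)) ∪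
    ((sep g x z ∩ PP g u) ∪ (sep g z x ∩ PP g u)) with hU
  have hfin : U.Finite :=
    (((hf _ _).union (hf _ _)).union ((hf _ _).union (hf _ _))).union ((hf _ _).union (hf _ _))
  have hmem : ∀ S ∈ hfin.toFinset, S ∈ PP g u := by
    intro S hS
    rw [Set.Finite.mem_toFinset, hU] at hS
    simp only [Set.mem_union, Set.mem_inter_iff] at hS
    tauto
  have hs : ∀ A : Set (Set (SurfaceGroup g)), A ⊆ U → A ⊆ hfin.toFinset := by
    intro A hA S hS
    simpa using hA hS
  rw [ee_sum u x z _ hmem (hs _ _) (hs _ _), ee_sum u x y _ hmem (hs _ _) (hs _ _),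
    ee_sum u y z _ hmem (hs _ _) (hs _ _), ← Finset.sum_add_distrib]
  · apply Finset.sum_congr rfl
    intro S _; ring
  all_goals
    rw [hU]; intro S hS
    simp only [Set.mem_union]
    tauto

lemma PP_smul {g : ℕ} (u S) : u • S ∈ PP g u ↔ S ∈ PP g u := by
  unfold PP
  simp only [Set.mem_ofPred_eq]
  constructor
  · rintro ⟨h1, h2⟩
    refine ⟨?_, (smul_ssub).1 h2⟩
    simpa using H_smul h1 u⁻¹
  · rintro ⟨h1, h2⟩
    exact ⟨H_smul h1 u, (smul_ssub).2 h2⟩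

lemma np_smul {g : ℕ} (u x y : SurfaceGroup g) : np g u (u*x) (u*y) = np g u x y := by
  unfold np
  rw [sep_smul]
  have : (fun S => u • S) '' sep g x y ∩ PP g u = (fun S => u • S) '' (sep g x y ∩ PP g u) := by
    ext S
    constructor
    · rintro ⟨⟨S, h1, rfl⟩, h2⟩
      exact ⟨S, ⟨h1, (PP_smul u S).1 h2⟩, rfl⟩
    · rintro ⟨S, ⟨h1, h2⟩, rfl⟩
      exact ⟨⟨S, h1, rfl⟩, (PP_smul u S).2 h2⟩
  rw [this, Set.ncard_image_of_injective]
  exact MulAction.injective u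

lemma ee_smul {g : ℕ} (u x y : SurfaceGroup g) : ee g u (u*x) (u*y) = ee g u x y := by
  unfold ee; rw [np_smul, np_smul]

lemma PP_mem {g : ℕ} (u x : SurfaceGroup g) (S) (hS : S ∈ PP g u) (hx : x ∈ S) : u * x ∈ S :=
  hS.2.1 (by rw [mem_tr]; simpa using hx)

lemma ee_self {g : ℕ} (u x : SurfaceGroup g) : ee g u x (u*x) = np g u x (u*x) := by
  unfold ee
  have : np g u (u*x) x = 0 := by
    unfold np
    have : sep g (u*x) x ∩ PP g u = ∅ := by
      ext S
      simp only [Set.mem_inter_iff, Set.mem_empty_iff_false, iff_false]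
      rintro ⟨⟨-, h1, h2⟩, h3⟩
      exact h1 (PP_mem u x S h3 h2)
    rw [this]; simp
  rw [this]; simp

lemma ee_zero {g : ℕ} (u x : SurfaceGroup g) : ee g u x x = 0 := by simp [ee]

lemma ee_swap {g : ℕ} (u x y : SurfaceGroup g) : ee g u x y = - ee g u y x := by simp [ee]

lemma np_indep {g : ℕ} (hg : 0 < g) (u x y : SurfaceGroup g) : np g u x (u*x) = np g u y (u*y) := by
  have h1 := ee_add hg u x y (u*x)
  have h2 := ee_add hg u y (u*y) (u*x)
  rw [ee_smul] at h2
  rw [h2, ee_self, ee_self, ee_swap u x y] at h1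
  omega

lemma ee_zpow {g : ℕ} (hg : 0 < g) (u x y : SurfaceGroup g) (k : ℤ) :
    ee g u x (u^k * y) = ee g u x y + k * np g u 1 u := by
  have step : ∀ z, ee g u x (u * z) = ee g u x z + np g u 1 u := by
    intro z
    rw [ee_add hg u x z (u*z), ee_self, np_indep hg u z 1, mul_one]
  induction k using Int.induction_on with
  | zero => simp
  | succ n ih =>
    rw [add_comm (n:ℤ) 1, zpow_add, zpow_one, mul_assoc, step, ih]; ring
  | pred n ih =>
    have := step (u^(-(n:ℤ)-1) * y)
    rw [← mul_assoc, ← zpow_one_add, show (1 + (-(n:ℤ)-1)) = -n by ring, ih] at this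
    linarith

lemma PP_pos {g : ℕ} (hg : 0 < g) (u S) (hS : S ∈ PP g u) : 0 < np g u 1 u := by
  obtain ⟨z, hz1, hz2⟩ := Set.exists_of_ssubset hS.2
  have h := np_indep hg u 1 (u⁻¹ * z)
  rw [mul_one, mul_inv_cancel_left] at h
  rw [h]
  unfold np
  rw [Set.ncard_pos ((sep_finite hg _ _).inter_of_left _)]
  refine ⟨S, ⟨hS.1, ?_, hz1⟩, hS⟩
  rw [← mem_tr]; exact hz2

/-- skewered half-spaces are absorbing -/
lemma absorb {g : ℕ} (hg : 0 < g) (u x : SurfaceGroup g) (S) (hS : S ∈ PP g u) :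
    ∃ N : ℕ, ∀ k : ℕ, N ≤ k → u^k * x ∈ S := by
  have hmono : ∀ (k l : ℕ) z, k ≤ l → u^k * z ∈ S → u^l * z ∈ S := by
    intro k l z hkl h
    induction l, hkl using Nat.le_induction with
    | base => exact h
    | succ l _ ih => rw [pow_succ', mul_assoc]; exact PP_mem u _ S hS ih
  suffices h : ∃ N : ℕ, u^N * x ∈ S by
    obtain ⟨N, hN⟩ := h
    exact ⟨N, fun k hk => hmono N k x hk hN⟩
  by_contra hn
  push Not at hn
  obtain ⟨y, hy, hy2⟩ := Set.exists_of_ssubset hS.2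
  let f : ℕ → Set (SurfaceGroup g) := fun k => (u^k)⁻¹ • S
  have hfm : ∀ k z, z ∈ f k ↔ u^k * z ∈ S := by
    intro k z; simp only [f]; rw [mem_tr, inv_inv]
  have hinj : Function.Injective f := by
    have aux : ∀ k l, k < l → f k ≠ f l := by
      intro k l hkl he
      have h1 : (u^l)⁻¹ * y ∈ f l := by rw [hfm]; simpa using hy
      rw [← he, hfm] at h1
      have h2 := hmono k (l-1) _ (by omega) h1
      have h3 : u^(l-1) * ((u^l)⁻¹ * y) = u⁻¹ * y := by
        obtain ⟨m, rfl⟩ : ∃ m, l = m+1 := ⟨l-1, by omega⟩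
        rw [pow_succ']; simp [mul_assoc]
      rw [h3, ← mem_tr] at h2
      exact hy2 h2
    intro k l he
    rcases lt_trichotomy k l with h | h | h
    · exact absurd he (aux k l h)
    · exact h
    · exact absurd he.symm (aux l k h)
  have hsub : Set.range f ⊆ sep g x y := by
    rintro _ ⟨k, rfl⟩
    refine ⟨H_smul hS.1 _, ?_, ?_⟩
    · rw [hfm]; exact hn k
    · rw [hfm]; exact hmono 0 k y (by omega) (by simpa using hy)
  exact Set.infinite_range_of_injective hinj ((sep_finite hg x y).subset hsub)

lemma PP_inv {g : ℕ} (u : SurfaceGroup g) (S) (hS : S ∈ PP g u) : Sᶜ ∈ PP g u⁻¹ := by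
  refine ⟨H_compl hS.1, ?_⟩
  rw [Set.smul_set_compl, compl_ssub]
  have := (smul_ssub (a := u⁻¹)).2 hS.2
  simpa using this

lemma absorb' {g : ℕ} (hg : 0 < g) (u x : SurfaceGroup g) (S) (hS : S ∈ PP g u) :
    ∃ N : ℕ, ∀ k : ℕ, N ≤ k → (u⁻¹)^k * x ∉ S := absorb hg u⁻¹ x _ (PP_inv u S hS)

lemma PP_Cr {g : ℕ} (hg : 0 < g) (u p q : SurfaceGroup g) (V W) (hV : V ∈ PP g u) (hW : W ∈ PP g u)
    (h1 : p ∉ V) (h2 : q ∈ V) (h3 : p ∈ W) (h4 : q ∉ W) : Cr V W := by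
  obtain ⟨N1, hN1⟩ := absorb hg u 1 V hV
  obtain ⟨N2, hN2⟩ := absorb hg u 1 W hW
  obtain ⟨N3, hN3⟩ := absorb' hg u 1 V hV
  obtain ⟨N4, hN4⟩ := absorb' hg u 1 W hW
  exact ⟨⟨_, hN1 (N1+N2) (by omega), hN2 (N1+N2) (by omega)⟩, ⟨q, h2, h4⟩, ⟨p, h1, h3⟩,
    ⟨_, hN3 (N3+N4) (by omega), hN4 (N3+N4) (by omega)⟩⟩

lemma H_nonempty {g : ℕ} (hg : 0 < g) (S) (hS : H g S) : ∃ x, x ∈ S := by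
  obtain ⟨x, a, rfl⟩ := hS
  exact ⟨_, mem_E hg x a⟩

lemma stable_Cr {g : ℕ} (hg : 0 < g) (u : SurfaceGroup g) (V W) (hV : H g V) (hs : u • V = V)
    (hW : W ∈ PP g u) : Cr V W := by
  have hst : ∀ x, u * x ∈ V ↔ x ∈ V := by
    intro x
    conv_lhs => rw [← hs, mem_tr]
    simp
  have hp : ∀ (k : ℕ) x, u^k * x ∈ V ↔ x ∈ V := by
    intro k
    induction k with
    | zero => simp
    | succ k ih => intro x; rw [pow_succ', mul_assoc, hst, ih]
  have hn : ∀ (k : ℕ) x, (u⁻¹)^k * x ∈ V ↔ x ∈ V := by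
    intro k x
    rw [← hp k]; simp
  obtain ⟨x, hx⟩ := H_nonempty hg V hV
  obtain ⟨y, hy⟩ := H_nonempty hg Vᶜ (H_compl hV)
  obtain ⟨N1, hN1⟩ := absorb hg u x W hW
  obtain ⟨N2, hN2⟩ := absorb hg u y W hW
  obtain ⟨N3, hN3⟩ := absorb' hg u x W hW
  obtain ⟨N4, hN4⟩ := absorb' hg u y W hW
  exact ⟨⟨_, (hp N1 x).2 hx, hN1 _ le_rfl⟩, ⟨_, (hn N3 x).2 hx, hN3 _ le_rfl⟩,
    ⟨_, fun h => hy ((hp N2 y).1 h), hN2 _ le_rfl⟩, ⟨_, fun h => hy ((hn N4 y).1 h), hN4 _ le_rfl⟩⟩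

lemma pigeon {g : ℕ} (X : Set (Set (SurfaceGroup g))) (hX : ∀ S ∈ X, H g S) 
    (hc : 2*g < X.ncard) : ∃ i, ∃ V ∈ X, ∃ V' ∈ X, V ≠ V' ∧ HS g i V ∧ HS g i V' := by
  classical
  have hpos : 0 < 2*g := by
    have : X.Nonempty := by
      apply Set.nonempty_of_ncard_ne_zero; omega
    obtain ⟨S, hS⟩ := this
    obtain ⟨x, a, -⟩ := hX S hS
    have := a.1.2
    omega
  have ht : ∀ S : Set (SurfaceGroup g), ∃ i, S ∈ X → HS g i S := by
    intro S
    by_cases h : S ∈ X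
    · obtain ⟨x, a, h⟩ := hX S h
      exact ⟨a.1, fun _ => ⟨x, a, rfl, h⟩⟩
    · exact ⟨⟨0, hpos⟩, fun h' => absurd h' h⟩
  choose f hf using ht
  have hX : X.Finite := Set.finite_of_ncard_pos (by omega)
  obtain ⟨V, hV, V', hV', hne, he⟩ := Set.exists_ne_map_eq_of_ncard_lt_of_maps_to (s := X)
    (t := (Set.univ : Set (Fin (2*g)))) (f := f) (by rw [Set.ncard_univ]; simpa using hc)
    (fun _ _ => Set.mem_univ _) (Set.finite_univ)
  refine ⟨f V, V, hV, V', hV', hne, hf V hV, ?_⟩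
  rw [he]; exact hf V' hV'

lemma HS_smul {g : ℕ} (i S) (hS : HS g i S) (u : SurfaceGroup g) : HS g i (u • S) := by
  obtain ⟨y, b, h, rfl⟩ := hS
  rw [smul_E]; exact ⟨_, _, h, rfl⟩

lemma m_bound {g : ℕ} (hg : 2 ≤ g) (u p q : SurfaceGroup g) (h : np g u q p ≤ np g u p q) :
    np g u q p ≤ 2*g := by
  have hg0 : 0 < g := by omega
  by_contra hn
  obtain ⟨i, V, hV, V', hV', hne, hVi, hVi'⟩ := pigeon (sep g p q ∩ PP g u) (fun S hS => hS.1.1) (by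
    unfold np at *; omega)
  obtain ⟨j, W, hW, W', hW', hneW, hWj, hWj'⟩ := pigeon (sep g q p ∩ PP g u) (fun S hS => hS.1.1) (by
    unfold np at *; omega)
  have cr : ∀ V ∈ sep g p q ∩ PP g u, ∀ W ∈ sep g q p ∩ PP g u, Cr V W := by
    rintro V ⟨⟨-, h1, h2⟩, h3⟩ W ⟨⟨-, h4, h5⟩, h6⟩
    exact PP_Cr hg0 u p q V W h3 h6 h1 h2 h5 h4
  rcases lemQ hg i j V V' W W' hVi hVi' hWj hWj' (cr _ hV _ hW) (cr _ hV' _ hW) (cr _ hV _ hW')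
    (cr _ hV' _ hW') with h | h | h | h
  · exact hne h
  · have h1 := hV.1.2.2
    rw [h] at h1; exact h1 hV'.1.2.2
  · exact hneW h
  · have h1 := hW.1.2.2
    rw [h] at h1; exact h1 hW'.1.2.2

lemma N0_bound {g : ℕ} (hg : 2 ≤ g) (u p q : SurfaceGroup g) (W) (hW : W ∈ PP g u) :
    {S ∈ sep g p q | u • S = S}.ncard ≤ 2*g := by
  have hg0 : 0 < g := by omega
  by_contra hn
  obtain ⟨i, V, hV, V', hV', hne, hVi, hVi'⟩ := pigeon {S ∈ sep g p q | u • S = S} (fun S hS => hS.1.1) (by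
    omega)
  obtain ⟨x, a, ha⟩ := hW.1
  have hWj : HS g a.1 W := ⟨x, a, rfl, ha⟩
  have hW2 := (PP_smul u W).2 hW
  rcases lemQ hg i a.1 V V' W (u • W) hVi hVi' hWj (HS_smul _ _ hWj u)
    (stable_Cr hg0 u _ _ hV.1.1 hV.2 hW) (stable_Cr hg0 u _ _ hV'.1.1 hV'.2 hW)
    (stable_Cr hg0 u _ _ hV.1.1 hV.2 hW2) (stable_Cr hg0 u _ _ hV'.1.1 hV'.2 hW2)
    with h | h | h | h
  · exact hne h
  · have h1 := hV.1.2.2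
    rw [h] at h1; exact h1 hV'.1.2.2
  · exact hW.2.ne h.symm
  · refine no_inversion hg0 hW.1 u ?_
    have := congrArg (fun S => Sᶜ) h
    simpa using this.symm

/-- the four-way alternative for half-spaces of same type -/
lemma nested {g : ℕ} (hg : 0 < g) (u : SurfaceGroup g) (S) (hS : H g S) :
    u • S ⊂ S ∨ S ⊂ u • S ∨ u • S = S ∨ (∀ x, x ∈ S → x ∉ u • S) ∨ (∀ x, x ∈ S ∨ x ∈ u • S) := by
  obtain ⟨x, a, ha⟩ := hS
  have h1 : HS g a.1 S := ⟨x, a, rfl, ha⟩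
  have h2 := not_Cr_same hg a.1 _ _ h1 (HS_smul _ _ h1 u)
  unfold Cr at h2
  by_contra hn
  push Not at hn
  obtain ⟨n1, n2, n3, n4, n5⟩ := hn
  apply h2
  refine ⟨n4, ?_, ?_, n5⟩
  · by_contra h
    push Not at h
    exact n2 (Set.ssubset_iff_subset_ne.2 ⟨h, fun he => n3 he.symm⟩)
  · by_contra h
    push Not at h
    refine n1 (Set.ssubset_iff_subset_ne.2 ⟨fun x hx => ?_, n3⟩)
    by_contra hx2
    exact h x hx2 hx

lemma r_bound {g : ℕ} (hg : 0 < g) (u p q : SurfaceGroup g) :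
    2 * {S ∈ sep g p q | ∀ x, x ∈ S → x ∉ u • S}.ncard + np g u q (u*q) ≤ d g q (u*q) := by
  set R := {S ∈ sep g p q | ∀ x, x ∈ S → x ∉ u • S} with hR
  set R2 := (fun S => (u • S)ᶜ) '' R with hR2
  set R3 := (fun S => Sᶜ) '' (sep g q (u*q) ∩ PP g u) with hR3
  have hRf : R.Finite := (sep_finite hg p q).subset (fun S hS => hS.1)
  have hR3f : R3.Finite := ((sep_finite hg q (u*q)).inter_of_left _).image _
  have c2 : R2.ncard = R.ncard := by
    apply Set.ncard_image_of_injective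
    intro S S' h
    simp only at h
    exact MulAction.injective u (compl_injective h)
  have c3 : R3.ncard = np g u q (u*q) := Set.ncard_image_of_injective _ compl_injective
  have d12 : Disjoint R R2 := by
    rw [Set.disjoint_left]
    rintro S h1 ⟨S', h2, h3⟩
    simp only at h3
    have e1 : S' ⊆ S := by
      intro x hx; rw [← h3]; exact h2.2 x hx
    have e2 : S ⊆ S' := by
      intro x hx
      have : u * x ∈ u • S := by rw [mem_tr]; simpa using hx
      have h4 : u * x ∉ S := fun h => h1.2 _ h this
      rw [← h3] at h4
      simp only [Set.mem_compl_iff, not_not] at h4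
      rw [mem_tr] at h4
      simpa using h4
    have e3 := Set.Subset.antisymm e1 e2
    subst e3
    refine no_inversion hg h1.1.1 u ?_
    have := congrArg (fun S => Sᶜ) h3
    simpa using this
  have d123 : Disjoint (R ∪ R2) R3 := by
    rw [Set.disjoint_left]
    rintro _ h1 ⟨S, h2, rfl⟩
    simp only at h1
    rcases h1 with h1 | ⟨S', h3, h4⟩
    · have := h1.2 q h1.1.2.2
      rw [Set.smul_set_compl, Set.mem_compl_iff, not_not] at this
      exact h1.1.2.2 (h2.2.2.1 this)
    · simp only at h4
      have h5 : u • S' = S := compl_injective h4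
      have h6 := h2.2
      rw [← h5, PP_smul] at h6
      obtain ⟨x, hx⟩ := H_nonempty hg _ h3.1.1
      exact h3.2 (u * x) (PP_mem u x S' h6 hx) (by rw [mem_tr]; simpa using hx)
  have hsub : R ∪ R2 ∪ R3 ⊆ sep g (u*q) q := by
    rintro S ((h | ⟨S', h, rfl⟩) | ⟨S', h, rfl⟩)
    · refine ⟨h.1.1, ?_, h.1.2.2⟩
      intro h1
      exact h.2 _ h1 (by rw [mem_tr]; simpa using h.1.2.2)
    · refine ⟨H_compl (H_smul h.1.1 u), ?_, ?_⟩
      · simp only [Set.mem_compl_iff, not_not]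
        rw [mem_tr]; simpa using h.1.2.2
      · exact h.2 _ h.1.2.2
    · exact ⟨H_compl h.1.1, by simpa using h.1.2.2, h.1.2.1⟩
  have := Set.ncard_le_ncard hsub (sep_finite hg _ _)
  rw [Set.ncard_union_eq d123 (hRf.union (hRf.image _)) hR3f, Set.ncard_union_eq d12 hRf (hRf.image _),
    c2, c3] at this
  have h2 := d_symm g q (u*q)
  unfold d at *
  omega

lemma r_bound' {g : ℕ} (hg : 0 < g) (u p q : SurfaceGroup g) :
    2 * {S ∈ sep g p q | ∀ x, x ∈ S ∨ x ∈ u • S}.ncard + np g u p (u*p) ≤ d g p (u*p) := by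
  have h := r_bound hg u q p
  have : {S ∈ sep g q p | ∀ x, x ∈ S → x ∉ u • S} =
      (fun S => Sᶜ) '' {S ∈ sep g p q | ∀ x, x ∈ S ∨ x ∈ u • S} := by
    ext S
    constructor
    · rintro ⟨⟨h1, h2, h3⟩, h4⟩
      refine ⟨Sᶜ, ⟨⟨H_compl h1, by simpa using h3, h2⟩, fun x => ?_⟩, by simp⟩
      rw [Set.smul_set_compl, Set.mem_compl_iff, Set.mem_compl_iff]
      have := h4 x
      tauto
    · rintro ⟨S, ⟨⟨h1, h2, h3⟩, h4⟩, rfl⟩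
      refine ⟨⟨H_compl h1, by simpa using h3, h2⟩, fun x => ?_⟩
      rw [Set.smul_set_compl, Set.mem_compl_iff, Set.mem_compl_iff]
      have := h4 x
      tauto
  rw [this, Set.ncard_image_of_injective _ compl_injective] at h
  exact h

lemma stable_PP {g : ℕ} (hg : 2 ≤ g) (u : SurfaceGroup g) (hu : u ≠ 1) (S) (hS : H g S)
    (hs : u • S = S) : ∃ W, W ∈ PP g u := by
  have hg0 : 0 < g := by omega
  obtain ⟨x, a, rfl⟩ := hS
  rw [smul_E] at hs
  have h1 := (E_eq hg0 _ _ _ _ hs.symm).2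
  obtain ⟨k, hk⟩ := Subgroup.mem_zpowers_iff.1 h1
  obtain ⟨w, hw1, hw2, hw3⟩ := A_word hg0 a k
  rw [hk] at hw2
  rcases w with _ | ⟨b, w⟩
  · rw [eval_nil] at hw2
    exfalso; apply hu
    have : u = x * (x⁻¹ * (u * x)) * x⁻¹ := by simp [mul_assoc]
    rw [this, ← hw2]; simp
  set v := x⁻¹ * (u * x) with hv
  have f1 : v ∈ E g 1 b := by
    have := SS_first hg0 b w hw1 1
    rwa [one_mul, hw2] at this
  have f2 : v * v ∈ E g 1 b := by
    have := SS_first hg0 b (w ++ b :: w) (by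
      intro c hc hc'
      refine hw1 c ?_ ?_
      · simp at hc ⊢; tauto
      · simp at hc' ⊢; tauto) 1
    rw [one_mul, ← List.cons_append, eval_append, hw2] at this
    exact this
  have f3 : v⁻¹ ∉ E g 1 b := by
    intro h
    rw [← hw2, ← eval_wordInv, ← one_mul (eval g _)] at h
    obtain ⟨w1, c, w2, h4, h5⟩ := enter_word hg0 (H_E 1 b) _ 1 (notMem_E hg0 1 b) h
    have h6 := (E_eq hg0 _ _ _ _ h5).1
    have h7 : b ∈ wordInv g (b :: w) := by rw [h4, h6]; simp
    simp only [wordInv, List.mem_reverse, List.mem_map] at h7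
    obtain ⟨c', hc', hc2⟩ := h7
    refine hw1 b (by simp) ?_
    have hbc : invLetter g b = c' := by rw [← hc2, invLetter_inv]
    rw [hbc]; exact hc'
  have hP : E g 1 b ∈ PP g v := by
    refine ⟨H_E _ _, ?_⟩
    have m1 : ∀ y, y ∈ v • E g 1 b ↔ v⁻¹ * y ∈ E g 1 b := fun y => mem_tr _ _ _
    rcases nested hg0 v (E g 1 b) (H_E _ _) with h | h | h | h | h
    · exact h
    · exfalso
      have := h.1 f1
      rw [m1, inv_mul_cancel] at this
      exact notMem_E hg0 _ _ this
    · exfalso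
      rw [← h, m1, inv_mul_cancel] at f1
      exact notMem_E hg0 _ _ f1
    · exfalso
      apply h _ f2
      rw [m1]; simpa using f1
    · exfalso
      rcases h 1 with h | h
      · exact notMem_E hg0 _ _ h
      · rw [m1, mul_one] at h; exact f3 h
  refine ⟨x • E g 1 b, H_smul hP.1 x, ?_⟩
  have := (smul_ssub (a := x)).2 hP.2
  rw [smul_smul] at this ⊢
  rw [hv, mul_inv_cancel_left] at this
  exact this

lemma main_ineq {g : ℕ} (hg : 2 ≤ g) (u p q : SurfaceGroup g)
    (h0 : {S ∈ sep g p q | u • S = S}.ncard ≤ 2*g) (h1 : np g u q p ≤ np g u p q)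
    (h2 : np g u p q ≤ np g u q p + np g u 1 u) :
    2 * d g p q ≤ d g p (u*p) + d g q (u*q) + 12*g := by
  have hg0 : 0 < g := by omega
  have hm := m_bound hg u p q h1
  have e1 := r_bound hg0 u p q
  have e2 := r_bound' hg0 u p q
  rw [np_indep hg0 u q 1, mul_one] at e1
  rw [np_indep hg0 u p 1, mul_one] at e2
  have hcov : sep g p q ⊆ (sep g p q ∩ PP g u) ∪ ((fun S => Sᶜ) '' (sep g q p ∩ PP g u)) ∪
     {S ∈ sep g p q | u • S = S} ∪ {S ∈ sep g p q | ∀ x, x ∈ S → x ∉ u • S} ∪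
     {S ∈ sep g p q | ∀ x, x ∈ S ∨ x ∈ u • S} := by
    intro S hS
    rcases nested hg0 u S hS.1 with h | h | h | h | h
    · exact Or.inl (Or.inl (Or.inl (Or.inl ⟨hS, hS.1, h⟩)))
    · refine Or.inl (Or.inl (Or.inl (Or.inr ⟨Sᶜ, ⟨?_, H_compl hS.1, ?_⟩, by simp⟩)))
      · exact ⟨H_compl hS.1, by simpa using hS.2.2, hS.2.1⟩
      · rw [Set.smul_set_compl, compl_ssub]; exact h
    · exact Or.inl (Or.inl (Or.inr ⟨hS, h⟩))
    · exact Or.inl (Or.inr ⟨hS, h⟩)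
    · exact Or.inr ⟨hS, h⟩
  have hf := sep_finite hg0 p q
  have hf' := sep_finite hg0 q p
  have hle := Set.ncard_le_ncard hcov (((((hf.inter_of_left _).union ((hf'.inter_of_left _).image _)).union
     (hf.subset (fun S hS => hS.1))).union (hf.subset (fun S hS => hS.1))).union (hf.subset (fun S hS => hS.1)))
  have u1 := Set.ncard_union_le ((sep g p q ∩ PP g u) ∪ ((fun S => Sᶜ) '' (sep g q p ∩ PP g u)) ∪
     {S ∈ sep g p q | u • S = S} ∪ {S ∈ sep g p q | ∀ x, x ∈ S → x ∉ u • S}) {S ∈ sep g p q | ∀ x, x ∈ S ∨ x ∈ u • S}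
  have u2 := Set.ncard_union_le ((sep g p q ∩ PP g u) ∪ ((fun S => Sᶜ) '' (sep g q p ∩ PP g u)) ∪
     {S ∈ sep g p q | u • S = S}) {S ∈ sep g p q | ∀ x, x ∈ S → x ∉ u • S}
  have u3 := Set.ncard_union_le ((sep g p q ∩ PP g u) ∪ ((fun S => Sᶜ) '' (sep g q p ∩ PP g u)))
     {S ∈ sep g p q | u • S = S}
  have u4 := Set.ncard_union_le (sep g p q ∩ PP g u) ((fun S => Sᶜ) '' (sep g q p ∩ PP g u))
  rw [Set.ncard_image_of_injective _ compl_injective] at u4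
  unfold np at *
  unfold d at *
  omega

theorem main_bound {g : ℕ} (hg : 2 ≤ g) (u q : SurfaceGroup g) (hu : u ≠ 1) :
    ∃ k : ℤ, 2 * len g (u^k * q) ≤ len g u + len g (q⁻¹ * u * q) + 12 * g := by
  have hg0 : 0 < g := by omega
  have fin : ∀ k : ℤ, {S ∈ sep g 1 (u^k*q) | u • S = S}.ncard ≤ 2*g →
      np g u (u^k*q) 1 ≤ np g u 1 (u^k*q) → np g u 1 (u^k*q) ≤ np g u (u^k*q) 1 + np g u 1 u →
      2 * len g (u^k * q) ≤ len g u + len g (q⁻¹ * u * q) + 12 * g := by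
    intro k a1 a2 a3
    have := main_ineq hg u 1 (u^k*q) a1 a2 a3
    rw [mul_one] at this
    rw [len_eq_d hg0, len_eq_d hg0, len_eq_d hg0]
    have h2 := d_smul g (u^k*q) 1 (q⁻¹ * u * q)
    rw [mul_one, show u^k*q*(q⁻¹*u*q) = u * (u^k * q) by
      rw [← mul_assoc u, ← zpow_one_add, add_comm, zpow_add_one]; simp [mul_assoc]] at h2
    omega
  by_cases hP : ∃ W, W ∈ PP g u
  · obtain ⟨W, hW⟩ := hP
    have hpos := PP_pos hg0 u W hW
    have hl : (0:ℤ) < np g u 1 u := by exact_mod_cast hpos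
    refine ⟨-(ee g u 1 q / np g u 1 u), fin _ (N0_bound hg u _ _ W hW) ?_ ?_⟩
    all_goals
      have h1 := ee_zpow hg0 u 1 q (-(ee g u 1 q / np g u 1 u))
      have h2 := Int.emod_add_mul_ediv (ee g u 1 q) (np g u 1 u)
      have h3 := Int.emod_nonneg (ee g u 1 q) hl.ne'
      have h4 := Int.emod_lt_of_pos (ee g u 1 q) hl
      have h5 : ee g u 1 (u ^ (-(ee g u 1 q / np g u 1 u)) * q) = ee g u 1 q % np g u 1 u := by
        rw [h1]; linarith
      unfold ee at h5 h3 h4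
      unfold ee
      omega
  · have hnp : ∀ x y, np g u x y = 0 := by
      intro x y
      unfold np
      have : sep g x y ∩ PP g u = ∅ := by
        ext S; simp only [Set.mem_inter_iff, Set.mem_empty_iff_false, iff_false]
        rintro ⟨-, h⟩; exact hP ⟨S, h⟩
      rw [this]; simp
    refine ⟨0, fin 0 ?_ (by rw [hnp, hnp]) (by rw [hnp, hnp, hnp])⟩
    have : {S ∈ sep g 1 (u^(0:ℤ)*q) | u • S = S} = ∅ := by
      ext S; simp only [Set.mem_ofPred_eq, Set.mem_empty_iff_false, iff_false]
      rintro ⟨h, hs⟩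
      exact hP (stable_PP hg u hu S h.1 hs)
    rw [this]; simp

end SGP

namespace SGP
open SG

lemma conjLen_le {g : ℕ} (u v x : SurfaceGroup g) (h : x⁻¹ * u * x = v) : conjLen g u v ≤ len g x :=
  Nat.sInf_le ⟨x, h, rfl⟩

lemma conjLen_bound {g : ℕ} (hg : 2 ≤ g) (n : ℕ) (u v : SurfaceGroup g)
    (h : ∃ x : SurfaceGroup g, x⁻¹ * u * x = v) (hl : len g u + len g v ≤ 2*n+1) :
    conjLen g u v ≤ n + 8*g - 1 := by
  obtain ⟨x, rfl⟩ := h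
  by_cases hu : u = 1
  · have h1 := conjLen_le u (x⁻¹ * u * x) 1 (by simp [hu])
    have h2 : len g (1 : SurfaceGroup g) ≤ 0 := len_le g []
    omega
  · obtain ⟨k, hk⟩ := main_bound hg u x hu
    have h1 := conjLen_le u (x⁻¹ * u * x) (u^k * x) (by
      rw [mul_inv_rev]
      have : (u^k)⁻¹ * u * u^k = u := by
        rw [mul_assoc, (Commute.zpow_self u k).eq.symm]; simp
      calc x⁻¹ * (u^k)⁻¹ * u * (u^k * x) = x⁻¹ * ((u^k)⁻¹ * u * u^k) * x := by simp only [mul_assoc]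
        _ = _ := by rw [this])
    omega

lemma Z_parity (g : ℕ) (m : ℕ) :
    Z g (fun _ => Multiplicative.ofAdd (1 : ZMod 2)) m = Multiplicative.ofAdd (m : ZMod 2) := by
  induction m with
  | zero => simp [Z_zero]
  | succ m ih =>
    rw [Z_succ, ih]
    have : cw g (fun _ => Multiplicative.ofAdd (1 : ZMod 2)) m = Multiplicative.ofAdd 1 := by
      unfold cw
      split_ifs
      · rfl
      · exact (by decide : (Multiplicative.ofAdd (1 : ZMod 2))⁻¹ = Multiplicative.ofAdd 1)
    rw [this, ← ofAdd_add]; push_cast; rfl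

lemma parity {g : ℕ} (hg : 0 < g) : ∃ φ : SurfaceGroup g →* Multiplicative (ZMod 2),
    ∀ x, φ x = Multiplicative.ofAdd (len g x : ZMod 2) := by
  obtain ⟨φ, hφ, -⟩ := exists_hom g hg (fun _ => Multiplicative.ofAdd (1 : ZMod 2)) (by
    rw [Z_parity]
    have : ((4*g : ℕ) : ZMod 2) = 0 := (ZMod.natCast_eq_zero_iff _ _).2 ⟨2*g, by ring⟩
    rw [this]; rfl)
  have key : ∀ w : Word g, φ (eval g w) = Multiplicative.ofAdd (w.length : ZMod 2) := by
    intro w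
    induction w with
    | nil => simp [eval_nil]
    | cons a w ih =>
      rw [eval_cons, map_mul, ih]
      have : φ (evalLetter g a) = Multiplicative.ofAdd (1 : ZMod 2) := by
        unfold evalLetter
        split_ifs
        · exact hφ _
        · rw [map_inv, hφ]; decide
      rw [this, ← ofAdd_add, List.length_cons, Nat.cast_succ, add_comm]
  refine ⟨φ, fun x => ?_⟩
  obtain ⟨w, h1, h2⟩ := exists_len g x
  rw [← h1, ← h2, key]

lemma conj_even {g : ℕ} (hg : 0 < g) (u x : SurfaceGroup g) :
    Even (len g u + len g (x⁻¹ * u * x)) := by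
  obtain ⟨φ, hφ⟩ := parity hg
  have h1 : φ (x⁻¹ * u * x) = φ u := by
    simp only [map_mul, map_inv]; rw [mul_comm, mul_inv_cancel_left]
  rw [hφ, hφ] at h1
  have h2 : ((len g (x⁻¹ * u * x) : ℕ) : ZMod 2) = (len g u : ZMod 2) := Multiplicative.ofAdd.injective h1
  rw [← ZMod.natCast_eq_zero_iff_even]
  push_cast
  rw [h2]
  exact CharTwo.add_self_eq_zero _

lemma CL_eq {g : ℕ} (hg : 0 < g) (n : ℕ) : CL g (2*n) = CL g (2*n+1) := by
  unfold CL
  congr 1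
  ext N
  simp only [Set.mem_ofPred_eq]
  constructor
  · rintro h u v ⟨x, rfl⟩ hl
    refine h u _ ⟨x, rfl⟩ ?_
    obtain ⟨t, ht⟩ := conj_even hg u x
    omega
  · intro h u v hx hl
    exact h u v hx (by omega)

lemma affine {g : ℕ} (hg : 2 ≤ g) : ∃ φ : SurfaceGroup g →* Equiv.Perm ℚ,
    (φ (gen g ⟨0, by omega⟩) = Equiv.addRight (1:ℚ)) ∧
    (φ (gen g ⟨1, by omega⟩) = Equiv.mulRight₀ (2:ℚ) two_ne_zero) ∧
    ∀ x, ∃ (e : ℤ) (t : ℚ), e ≤ len g x ∧ ∀ q, φ x q = 2^e * q + t := by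
  obtain ⟨φ, hφ, -⟩ := exists_hom3 (K := Equiv.Perm ℚ) g 0 1 2 (by omega) (Equiv.addRight (1:ℚ))
    (Equiv.mulRight₀ (2:ℚ) two_ne_zero) (Equiv.addRight (1:ℚ)) (by omega) (by omega) (by omega) rfl
  refine ⟨φ, by rw [hφ]; rfl, by rw [hφ]; rfl, ?_⟩
  have hlet : ∀ a : Letter g, ∃ (e : ℤ) (t : ℚ), e ≤ 1 ∧ ∀ q, φ (evalLetter g a) q = 2^e * q + t := by
    rintro ⟨i, b⟩
    have hi := hφ i
    cases b
    · rw [evalLetter_false, map_inv, hi]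
      unfold f3
      split_ifs
      · exact ⟨0, -1, by omega, fun q => by rw [Equiv.Perm.inv_eq_iff_eq]; simp⟩
      · exact ⟨-1, 0, by omega, fun q => by rw [Equiv.Perm.inv_eq_iff_eq]; simp; ring⟩
      · exact ⟨0, -1, by omega, fun q => by rw [Equiv.Perm.inv_eq_iff_eq]; simp⟩
      · exact ⟨0, 0, by omega, fun q => by simp⟩
    · rw [evalLetter_true, hi]
      unfold f3
      split_ifs
      · exact ⟨0, 1, by omega, fun q => by simp⟩
      · exact ⟨1, 0, by omega, fun q => by simp; ring⟩
      · exact ⟨0, 1, by omega, fun q => by simp⟩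
      · exact ⟨0, 0, by omega, fun q => by simp⟩
  have key : ∀ w : Word g, ∃ (e : ℤ) (t : ℚ), e ≤ w.length ∧ ∀ q, φ (eval g w) q = 2^e * q + t := by
    intro w
    induction w with
    | nil => exact ⟨0, 0, by simp, fun q => by simp [eval_nil]⟩
    | cons a w ih =>
      obtain ⟨e, t, h1, h2⟩ := ih
      obtain ⟨e', t', h3, h4⟩ := hlet a
      refine ⟨e' + e, 2^e' * t + t', by simp; omega, fun q => ?_⟩
      rw [eval_cons, map_mul, Equiv.Perm.mul_apply, h2, h4, zpow_add₀ two_ne_zero]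
      ring
  intro x
  obtain ⟨w, h1, h2⟩ := exists_len g x
  obtain ⟨e, t, h3, h4⟩ := key w
  exact ⟨e, t, by omega, by rw [← h2]; exact h4⟩

lemma eval_replicate (g : ℕ) (a : Letter g) (m : ℕ) :
    eval g (List.replicate m a) = evalLetter g a ^ m := by
  simp [eval]

lemma lower {g : ℕ} (hg : 2 ≤ g) (m : ℕ) : m ≤ conjLen g (gen g ⟨0, by omega⟩)
    ((gen g ⟨1, by omega⟩ ^ m)⁻¹ * gen g ⟨0, by omega⟩ * gen g ⟨1, by omega⟩ ^ m) := by
  set a := gen g ⟨0, by omega⟩ with ha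
  set b := gen g ⟨1, by omega⟩ with hb
  obtain ⟨x, h1, h2⟩ : conjLen g a ((b^m)⁻¹ * a * b^m) ∈
    {k | ∃ x : SurfaceGroup g, x⁻¹ * a * x = (b^m)⁻¹ * a * b^m ∧ len g x = k} :=
      Nat.sInf_mem ⟨_, b^m, rfl, rfl⟩
  rw [← h2]
  obtain ⟨φ, fa, fb, hφ⟩ := affine hg
  rw [← ha] at fa
  rw [← hb] at fb
  obtain ⟨e, t, h3, h4⟩ := hφ x
  have hpow : ∀ (m : ℕ) (q : ℚ), (φ b ^ m) q = 2^m * q := by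
    intro m
    induction m with
    | zero => simp
    | succ m ih =>
      intro q
      rw [pow_succ, Equiv.Perm.mul_apply, ih, fb]; simp; ring
  have hv : φ ((b^m)⁻¹ * a * b^m) 0 = (2^m)⁻¹ := by
    simp only [map_mul, map_inv, map_pow, Equiv.Perm.mul_apply]
    rw [Equiv.Perm.inv_eq_iff_eq, hpow, hpow, fa]
    simp
  have h5 : a * x = x * ((b^m)⁻¹ * a * b^m) := by rw [← h1]; simp [mul_assoc]
  have h6 : φ (a * x) 0 = φ (x * ((b^m)⁻¹ * a * b^m)) 0 := by rw [h5]
  rw [map_mul, map_mul, Equiv.Perm.mul_apply, Equiv.Perm.mul_apply, hv, h4, h4, fa] at h6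
  have h7 : (1:ℚ) = 2^e * (2^m)⁻¹ := by
    simp at h6; linarith
  have h8 : (2:ℚ)^e = 2^(m:ℤ) := by
    rw [zpow_natCast]; field_simp at h7; exact h7.symm
  have h9 : e = m := zpow_right_injective₀ (by norm_num : (0:ℚ) < 2) (by norm_num) h8
  omega

lemma CL_lower {g : ℕ} (hg : 2 ≤ g) (n : ℕ) (hn : 1 ≤ n) : n - 1 ≤ CL g (2*n) := by
  have hmem : CL g (2*n) ∈ {N | ∀ u v : SurfaceGroup g,
    (∃ x : SurfaceGroup g, x⁻¹ * u * x = v) → len g u + len g v ≤ 2*n → conjLen g u v ≤ N} :=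
    Nat.sInf_mem ⟨n + 8*g - 1, fun u v h hl => conjLen_bound hg n u v h (by omega)⟩
  refine le_trans (lower hg (n-1)) (hmem _ _ ⟨_, rfl⟩ ?_)
  have h1 := len_le g [(⟨0, by omega⟩, true)]
  have h2 := len_le g (List.replicate (n-1) ((⟨1, by omega⟩, false) : Letter g) ++
    (((⟨0, by omega⟩, true) : Letter g) :: List.replicate (n-1) ((⟨1, by omega⟩, true) : Letter g)))
  rw [eval_cons, eval_nil, mul_one, evalLetter_true] at h1
  rw [eval_append, eval_cons, eval_replicate, eval_replicate, evalLetter_true, evalLetter_true,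
    evalLetter_false, inv_pow, ← mul_assoc] at h2
  simp only [List.length_append, List.length_cons, List.length_replicate, List.length_nil] at h1 h2
  omega

lemma CL_upper {g : ℕ} (hg : 2 ≤ g) (n : ℕ) : CL g (2*n+1) ≤ n + 8*g - 1 :=
  Nat.sInf_le fun u v h hl => conjLen_bound hg n u v h hl

end SGP

/-- For the surface group of genus `g ≥ 2`, for every `n ≥ 1`,
`n − 1 ≤ CL(2n) = CL(2n+1) ≤ n + 8g − 1`. -/
theorem surface_group_conjugator_length (g : ℕ) (hg : 2 ≤ g) (n : ℕ) (hn : 1 ≤ n) :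
    n - 1 ≤ SG.CL g (2*n) ∧ SG.CL g (2*n) = SG.CL g (2*n+1) ∧
      SG.CL g (2*n+1) ≤ n + 8*g - 1 := by
  exact ⟨SGP.CL_lower hg n hn, SGP.CL_eq (by omega) n, SGP.CL_upper hg n⟩
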